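/- arXiv:2101.11682 — 9 statements merged into one kernel-verified Lean document; each statement's English description precedes it below -/
import Mathlib

section
/- Let μ_A, μ_B ∈ ℝ, σ_A, σ_B > 0, τ_A, τ_B > 0. Let X and Y be independent real-valued random variables on a probability space, where X has the Ex-Gaussian distribution ExG(μ_A, σ_A, τ_A) and Y has the Ex-Gaussian distribution ExG(μ_B, σ_B, τ_B). Then the law of Y − X equals the Asymmetric Laplace–Gaussian distribution ALG(τ_A, τ_B, μ_B − μ_A, √(σ_A² + σ_B²)); that is, the law of Y − X equals the law of (E₂ − E₁) + N where E₁, E₂, N are mutually independent, E₁ is exponential with mean τ_A, E₂ is exponential with mean τ_B, and N is Gaussian with mean μ_B − μ_A and variance σ_A² + σ_B². -/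
open MeasureTheory ProbabilityTheory Real Filter

/-- The Ex-Gaussian distribution `ExG(μ, σ, τ)`: the law of `N + E` where `N` is Gaussian with
mean `μ` and variance `σ²` and `E` is exponential with mean `τ` (rate `1/τ`), independent. -/
noncomputable def ExG (μ σ τ : ℝ) : Measure ℝ :=
  (gaussianReal μ (σ ^ 2).toNNReal).conv (expMeasure τ⁻¹)

/-- The Asymmetric Laplace distribution `AL(α₁, α₂)`: the law of `E₂ - E₁` where `E₁, E₂` are
independent exponentials with means `α₁` and `α₂` respectively. -/
noncomputable def AL (α₁ α₂ : ℝ) : Measure ℝ :=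
  (expMeasure α₂⁻¹).conv ((expMeasure α₁⁻¹).map (fun x => -x))

/-- The Asymmetric Laplace–Gaussian distribution `ALG(α₁, α₂, μ, σ)`: the law of `L + N` where
`L ~ AL(α₁, α₂)` and `N` is Gaussian with mean `μ` and variance `σ²`, independent. -/
noncomputable def ALG (α₁ α₂ μ σ : ℝ) : Measure ℝ :=
  (AL α₁ α₂).conv (gaussianReal μ (σ ^ 2).toNNReal)

/-- The standard normal cumulative distribution function `Φ`. -/
noncomputable def stdNormCDF (x : ℝ) : ℝ := ((gaussianReal 0 1) (Set.Iic x)).toReal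

/-- If `X ~ ExG(μ_A, σ_A, τ_A)` and `Y ~ ExG(μ_B, σ_B, τ_B)` are independent, then
the law of `Y - X` is `ALG(τ_A, τ_B, μ_B - μ_A, √(σ_A² + σ_B²))`. -/
theorem law_sub_exGaussian_eq_ALG {Ω : Type*} [MeasurableSpace Ω]
    (P : Measure Ω) [IsProbabilityMeasure P]
    (μA μB σA σB τA τB : ℝ) (hσA : 0 < σA) (hσB : 0 < σB) (hτA : 0 < τA) (hτB : 0 < τB)
    (X Y : Ω → ℝ) (hX : Measurable X) (hY : Measurable Y) (hXY : IndepFun X Y P)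
    (hlawX : P.map X = ExG μA σA τA) (hlawY : P.map Y = ExG μB σB τB) :
    P.map (fun ω => Y ω - X ω)
      = ALG τA τB (μB - μA) (Real.sqrt (σA ^ 2 + σB ^ 2)) := by
  have := isProbabilityMeasure_expMeasure (inv_pos.mpr hτA)
  have := isProbabilityMeasure_expMeasure (inv_pos.mpr hτB)
  have hneg : ∀ a b : Measure ℝ, IsProbabilityMeasure a → IsProbabilityMeasure b →
      (a.conv b).map (fun x => -x) = (a.map (fun x => -x)).conv (b.map (fun x => -x)) := by
    intro a b _ _
    exact Measure.map_conv_addMonoidHom (negAddMonoidHom : ℝ →+ ℝ) measurable_neg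
  have h1 : P.map (fun ω => Y ω - X ω)
      = (P.map Y).conv ((P.map X).map (fun x => -x)) := by
    have hI : IndepFun Y (fun ω => -X ω) P := hXY.symm.comp measurable_id measurable_neg
    rw [Measure.map_map measurable_neg hX]
    have := hI.map_add_eq_map_conv_map hY hX.neg
    simp only [sub_eq_add_neg]
    exact this
  have hv : (Real.sqrt (σA ^ 2 + σB ^ 2) ^ 2).toNNReal
      = (σB ^ 2).toNNReal + (σA ^ 2).toNNReal := by
    rw [Real.sq_sqrt (by positivity), add_comm, Real.toNNReal_add (by positivity) (by positivity)]
  rw [h1, hlawX, hlawY, ExG, ExG, ALG, AL, hneg _ _ inferInstance inferInstance,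
    gaussianReal_map_neg, hv, sub_eq_add_neg, ← gaussianReal_conv_gaussianReal]
  have : IsProbabilityMeasure ((expMeasure τA⁻¹).map (fun x => -x)) :=
    Measure.isProbabilityMeasure_map measurable_neg.aemeasurable
  generalize (expMeasure τA⁻¹).map (fun x => -x) = eA at *
  generalize expMeasure τB⁻¹ = eB at *
  generalize hgA : gaussianReal (-μA) _ = gA
  generalize hgB : gaussianReal μB _ = gB
  have : IsProbabilityMeasure gA := hgA ▸ inferInstance
  have : IsProbabilityMeasure gB := hgB ▸ inferInstance
  rw [Measure.conv_comm gB eB, Measure.conv_comm gA eA, Measure.conv_assoc eB gB,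
    Measure.conv_assoc eB eA, ← Measure.conv_assoc gB eA gA, Measure.conv_comm gB eA,
    Measure.conv_assoc eA gB gA]
end

section
/- Let μ ∈ ℝ, σ > 0, τ > 0. The Ex-Gaussian distribution ExG(μ, σ, τ) is absolutely continuous with respect to Lebesgue measure on ℝ, with density f(t) = (1/τ) · exp((μ − t)/τ + σ²/(2τ²)) · Φ((t − μ)/σ − σ/τ) for t ∈ ℝ, where Φ denotes the standard normal cumulative distribution function. -/
open MeasureTheory ProbabilityTheory Real Filter

lemma gaussian_Iic_eq_std (m σ t : ℝ) (hσ : 0 < σ) :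
    gaussianReal m (σ ^ 2).toNNReal (Set.Iic t) = gaussianReal 0 1 (Set.Iic ((t - m) / σ)) := by
  have h1 : gaussianReal m (σ ^ 2).toNNReal
      = ((gaussianReal 0 1).map (fun x => σ * x)).map (fun x => x + m) := by
    rw [gaussianReal_map_const_mul, gaussianReal_map_add_const]
    congr 1
    · simp
    · ext
      simp [sq_nonneg]
  rw [h1, Measure.map_map (by fun_prop) (by fun_prop),
    Measure.map_apply (by fun_prop) measurableSet_Iic]
  congr 1
  ext x
  simp only [Set.mem_preimage, Function.comp, Set.mem_Iic]
  rw [le_div_iff₀ hσ]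
  constructor <;> intro h <;> linarith

lemma exG_pointwise (μ σ τ t y : ℝ) (hσ : 0 < σ) (hτ : 0 < τ) :
    gaussianPDF μ (σ ^ 2).toNNReal y * exponentialPDF τ⁻¹ (-y + t) =
      ENNReal.ofReal ((1 / τ) * Real.exp ((μ - t) / τ + σ ^ 2 / (2 * τ ^ 2))) *
        (Set.Iic t).indicator (gaussianPDF (μ + σ ^ 2 / τ) (σ ^ 2).toNNReal) y := by
  by_cases hy : y ≤ t
  · rw [Set.indicator_of_mem (by exact hy), exponentialPDF_of_nonneg (by linarith),
      gaussianPDF, gaussianPDF, ← ENNReal.ofReal_mul (gaussianPDFReal_nonneg _ _ _),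
      ← ENNReal.ofReal_mul (by positivity)]
    congr 1
    rw [gaussianPDFReal, gaussianPDFReal, Real.coe_toNNReal _ (sq_nonneg σ)]
    have key : Real.exp (-(y - μ) ^ 2 / (2 * σ ^ 2)) * Real.exp (-(τ⁻¹ * (-y + t)))
        = Real.exp ((μ - t) / τ + σ ^ 2 / (2 * τ ^ 2)) *
          Real.exp (-(y - (μ + σ ^ 2 / τ)) ^ 2 / (2 * σ ^ 2)) := by
      rw [← Real.exp_add, ← Real.exp_add]
      congr 1
      field_simp
      ring
    rw [one_div]
    linear_combination (τ⁻¹ * (√(2 * π * σ ^ 2))⁻¹) * key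
  · rw [Set.indicator_of_notMem (by exact hy), exponentialPDF_of_neg (by linarith)]
    simp

/-- `ExG(μ, σ, τ)` is absolutely continuous with respect to Lebesgue measure with
density `f(t) = (1/τ)·exp((μ - t)/τ + σ²/(2τ²))·Φ((t - μ)/σ - σ/τ)`. -/
theorem exGaussian_eq_withDensity (μ σ τ : ℝ) (hσ : 0 < σ) (hτ : 0 < τ) :
    ExG μ σ τ ≪ volume ∧
    ExG μ σ τ = volume.withDensity (fun t => ENNReal.ofReal
      ((1 / τ) * Real.exp ((μ - t) / τ + σ ^ 2 / (2 * τ ^ 2)) *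
        stdNormCDF ((t - μ) / σ - σ / τ))) := by
  have hv : (σ ^ 2).toNNReal ≠ 0 := by
    have : 0 < σ ^ 2 := by positivity
    simpa using this.ne'
  have h : ExG μ σ τ = volume.withDensity (fun t => ENNReal.ofReal
      ((1 / τ) * Real.exp ((μ - t) / τ + σ ^ 2 / (2 * τ ^ 2)) *
        stdNormCDF ((t - μ) / σ - σ / τ))) := by
    have he : expMeasure τ⁻¹ = volume.withDensity (exponentialPDF τ⁻¹) := rfl
    have hm : Measurable (exponentialPDF τ⁻¹) :=
      (measurable_exponentialPDFReal _).ennreal_ofReal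
    rw [ExG, he, gaussianReal_of_var_ne_zero _ hv,
      conv_withDensity_eq_lconvolution (measurable_gaussianPDF _ _) hm]
    congr 1
    ext t
    rw [lconvolution_def]
    simp_rw [exG_pointwise μ σ τ t _ hσ hτ]
    rw [lintegral_const_mul _ ((measurable_gaussianPDF _ _).indicator measurableSet_Iic),
      lintegral_indicator measurableSet_Iic, ← gaussianReal_apply _ hv,
      gaussian_Iic_eq_std _ _ _ hσ, ENNReal.ofReal_mul (q := stdNormCDF _) (by positivity), stdNormCDF,
      ENNReal.ofReal_toReal (measure_ne_top _ _)]
    congr 4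
    field_simp
    ring
  refine ⟨?_, h⟩
  rw [h]
  exact withDensity_absolutelyContinuous _ _
end

section
/- Let α₁, α₂ > 0, μ ∈ ℝ, σ > 0. The Asymmetric Laplace–Gaussian distribution ALG(α₁, α₂, μ, σ) is absolutely continuous with respect to Lebesgue measure on ℝ, with density f(t) = (α₁ + α₂)⁻¹ · [ exp( (σ/(2α₂)) · (σ/α₂ − 2(t − μ)/σ) ) · (1 − Φ(σ/α₂ − (t − μ)/σ)) + exp( (σ/(2α₁)) · (σ/α₁ + 2(t − μ)/σ) ) · (1 − Φ(σ/α₁ + (t − μ)/σ)) ] for t ∈ ℝ, where Φ denotes the standard normal cumulative distribution function. -/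
open MeasureTheory ProbabilityTheory Real Filter

theorem aux_gauss_Ioi (m σ : ℝ) (hσ : 0 < σ) :
    gaussianReal m (σ ^ 2).toNNReal (Set.Ioi 0) = ENNReal.ofReal (1 - stdNormCDF (-m / σ)) := by
  have h1 : gaussianReal m (σ ^ 2).toNNReal = (gaussianReal 0 1).map (fun x => σ * x + m) := by
    have : (fun x : ℝ => σ * x + m) = (fun x => x + m) ∘ (fun x => σ * x) := rfl
    rw [this, ← Measure.map_map (by fun_prop) (by fun_prop), gaussianReal_map_const_mul,
      gaussianReal_map_add_const]
    congr 1
    · simp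
    · ext; simp [sq_nonneg]
  rw [h1, Measure.map_apply (by fun_prop) measurableSet_Ioi]
  have h2 : (fun x : ℝ => σ * x + m) ⁻¹' Set.Ioi 0 = (Set.Iic (-m / σ))ᶜ := by
    ext x
    simp only [Set.mem_preimage, Set.mem_Ioi, Set.mem_compl_iff, Set.mem_Iic, not_le,
      div_lt_iff₀ hσ]
    constructor <;> intro h <;> linarith
  rw [h2, prob_compl_eq_one_sub measurableSet_Iic, stdNormCDF,
    ENNReal.ofReal_sub _ ENNReal.toReal_nonneg, ENNReal.ofReal_toReal (measure_ne_top _ _),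
    ENNReal.ofReal_one]

theorem aux_gauss_Iic (m σ : ℝ) (hσ : 0 < σ) :
    gaussianReal m (σ ^ 2).toNNReal (Set.Iic 0) = ENNReal.ofReal (1 - stdNormCDF (m / σ)) := by
  have h0 : (σ ^ 2).toNNReal ≠ 0 := by
    simp only [ne_eq, Real.toNNReal_eq_zero, not_le]; positivity
  have := nullSingletonClass_gaussianReal (μ := -m) h0
  have h1 : gaussianReal m (σ ^ 2).toNNReal
      = (gaussianReal (-m) (σ ^ 2).toNNReal).map (fun x => -x) := by
    rw [gaussianReal_map_neg, neg_neg]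
  have h2 : (fun x : ℝ => -x) ⁻¹' Set.Iic 0 = Set.Ici 0 := by ext x; simp
  rw [h1, Measure.map_apply (by fun_prop) measurableSet_Iic, h2,
    ← measure_congr Ioi_ae_eq_Ici, aux_gauss_Ioi _ _ hσ, neg_neg]

theorem aux_shift (a μ σ t y : ℝ) (hσ : 0 < σ) :
    Real.exp (a * y) * gaussianPDFReal μ (σ ^ 2).toNNReal (-y + t) =
      Real.exp (σ ^ 2 * a ^ 2 / 2 + a * (t - μ)) *
        gaussianPDFReal (t - μ + σ ^ 2 * a) (σ ^ 2).toNNReal y := by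
  simp only [gaussianPDFReal, Real.coe_toNNReal _ (sq_nonneg σ)]
  rw [mul_left_comm, mul_left_comm (Real.exp (σ ^ 2 * a ^ 2 / 2 + a * (t - μ))),
    ← Real.exp_add, ← Real.exp_add]
  congr 2
  field_simp
  ring

theorem aux_set (a μ σ t : ℝ) (hσ : 0 < σ) (s : Set ℝ) :
    ∫⁻ y in s, ENNReal.ofReal (Real.exp (a * y)) * gaussianPDF μ (σ ^ 2).toNNReal (-y + t) =
      ENNReal.ofReal (Real.exp (σ ^ 2 * a ^ 2 / 2 + a * (t - μ))) *
        gaussianReal (t - μ + σ ^ 2 * a) (σ ^ 2).toNNReal s := by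
  have h0 : (σ ^ 2).toNNReal ≠ 0 := by
    simp only [ne_eq, Real.toNNReal_eq_zero, not_le]; positivity
  rw [gaussianReal_apply _ h0, ← lintegral_const_mul _ (measurable_gaussianPDF _ _)]
  refine lintegral_congr fun y => ?_
  simp only [gaussianPDF]
  rw [← ENNReal.ofReal_mul (Real.exp_pos _).le, ← ENNReal.ofReal_mul (Real.exp_pos _).le,
    aux_shift _ _ _ _ _ hσ]

theorem aux_expInt (c m : ℝ) (hc : 0 < c) :
    ∫⁻ y in Set.Ici m, ENNReal.ofReal (Real.exp (-c * y)) =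
      ENNReal.ofReal (Real.exp (-c * m) / c) := by
  rw [setLIntegral_congr Ioi_ae_eq_Ici.symm, ← ofReal_integral_eq_lintegral_ofReal
    (integrableOn_exp_mul_Ioi (by linarith) m) (ae_of_all _ fun _ => (Real.exp_pos _).le),
    integral_exp_mul_Ioi (by linarith)]
  congr 1
  field_simp

/-- density of the asymmetric Laplace law -/
noncomputable def auxAL (α₁ α₂ x : ℝ) : ENNReal :=
  ENNReal.ofReal (α₁ + α₂)⁻¹ *
    ENNReal.ofReal (if 0 < x then Real.exp (-α₂⁻¹ * x) else Real.exp (α₁⁻¹ * x))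

theorem auxAL_meas (α₁ α₂ : ℝ) : Measurable (auxAL α₁ α₂) := by
  unfold auxAL
  refine Measurable.const_mul (ENNReal.measurable_ofReal.comp ?_) _
  exact Measurable.ite measurableSet_Ioi (by fun_prop) (by fun_prop)

theorem expPDF_meas (r : ℝ) : Measurable (exponentialPDF r) :=
  ENNReal.measurable_ofReal.comp (measurable_exponentialPDFReal r)

theorem aux_map (r : ℝ) : (expMeasure r).map (fun x => -x) =
    volume.withDensity (fun x => exponentialPDF r (-x)) := by
  have h : expMeasure r = volume.withDensity (exponentialPDF r) := rfl
  ext s hs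
  rw [Measure.map_apply (by fun_prop) hs, h, withDensity_apply _ hs,
    withDensity_apply _ (measurable_neg hs), ← lintegral_indicator hs,
    ← lintegral_indicator (measurable_neg hs), ← lintegral_neg_eq_self]
  refine lintegral_congr fun x => ?_
  by_cases hx : x ∈ s
  · rw [Set.indicator_of_mem hx, Set.indicator_of_mem (by rw [Set.mem_preimage, neg_neg]; exact hx)]
  · rw [Set.indicator_of_notMem hx,
      Set.indicator_of_notMem (by rw [Set.mem_preimage, neg_neg]; exact hx)]

theorem aux_AL (α₁ α₂ : ℝ) (h₁ : 0 < α₁) (h₂ : 0 < α₂) :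
    AL α₁ α₂ = volume.withDensity (auxAL α₁ α₂) := by
  have h : expMeasure α₂⁻¹ = volume.withDensity (exponentialPDF α₂⁻¹) := rfl
  have hm := expPDF_meas α₁⁻¹
  rw [AL, aux_map, h, conv_withDensity_eq_lconvolution (expPDF_meas _)
    (by fun_prop)]
  congr 1
  funext x
  rw [lconvolution_def]
  have key : ∀ y : ℝ, exponentialPDF α₂⁻¹ y * exponentialPDF α₁⁻¹ (-(-y + x)) =
      (Set.Ici (max 0 x)).indicator (fun y => ENNReal.ofReal (α₁⁻¹ * α₂⁻¹ * Real.exp (α₁⁻¹ * x)) *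
        ENNReal.ofReal (Real.exp (-(α₁⁻¹ + α₂⁻¹) * y))) y := by
    intro y
    by_cases hy : y ∈ Set.Ici (max 0 x)
    · rw [Set.indicator_of_mem hy]
      simp only [Set.mem_Ici, max_le_iff] at hy
      rw [exponentialPDF_of_nonneg hy.1, exponentialPDF_of_nonneg (by linarith),
        ← ENNReal.ofReal_mul (by positivity), ← ENNReal.ofReal_mul (by positivity)]
      congr 1
      rw [mul_mul_mul_comm, ← Real.exp_add, mul_assoc (α₁⁻¹ * α₂⁻¹), ← Real.exp_add,
        mul_comm α₁⁻¹ α₂⁻¹]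
      congr 2
      ring
    · rw [Set.indicator_of_notMem hy]
      simp only [Set.mem_Ici, max_le_iff, not_and_or, not_le] at hy
      rcases hy with hy | hy
      · rw [exponentialPDF_of_neg hy, zero_mul]
      · rw [exponentialPDF_of_neg (x := -(-y + x)) (by linarith), mul_zero]
  rw [lintegral_congr key, lintegral_indicator measurableSet_Ici,
    lintegral_const_mul _ (by fun_prop), aux_expInt _ _ (by positivity), auxAL,
    ← ENNReal.ofReal_mul (by positivity), ← ENNReal.ofReal_mul (by positivity)]
  congr 1
  have e : ∀ A B : ℝ, α₁⁻¹ * α₂⁻¹ * A * (B / (α₁⁻¹ + α₂⁻¹)) = (α₁ + α₂)⁻¹ * (A * B) := by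
    intro A B; field_simp; ring
  rw [e, ← Real.exp_add]
  congr 1
  split_ifs with hx
  · rw [max_eq_right hx.le]; congr 1; ring
  · rw [max_eq_left (not_lt.1 hx)]; simp

theorem ALG_eq_withDensity (α₁ α₂ μ σ : ℝ) (hα₁ : 0 < α₁) (hα₂ : 0 < α₂) (hσ : 0 < σ) :
    ALG α₁ α₂ μ σ ≪ volume ∧
    ALG α₁ α₂ μ σ = volume.withDensity (fun t => ENNReal.ofReal
      ((α₁ + α₂)⁻¹ *
        (Real.exp ((σ / (2 * α₂)) * (σ / α₂ - 2 * (t - μ) / σ)) *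
            (1 - stdNormCDF (σ / α₂ - (t - μ) / σ)) +
         Real.exp ((σ / (2 * α₁)) * (σ / α₁ + 2 * (t - μ) / σ)) *
            (1 - stdNormCDF (σ / α₁ + (t - μ) / σ))))) := by
  suffices h : ALG α₁ α₂ μ σ = _ from ⟨h ▸ withDensity_absolutelyContinuous _ _, h⟩
  have h0 : (σ ^ 2).toNNReal ≠ 0 := by
    simp only [ne_eq, Real.toNNReal_eq_zero, not_le]; positivity
  have hle : ∀ z, 0 ≤ 1 - stdNormCDF z := by
    intro z
    have : stdNormCDF z ≤ 1 := measureReal_le_one (μ := gaussianReal 0 1)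
    linarith
  rw [ALG, aux_AL _ _ hα₁ hα₂, gaussianReal_of_var_ne_zero _ h0,
    conv_withDensity_eq_lconvolution (auxAL_meas _ _) (measurable_gaussianPDF _ _)]
  congr 1
  funext t
  rw [lconvolution_def]
  simp only [auxAL, mul_assoc]
  rw [lintegral_const_mul' _ _ ENNReal.ofReal_ne_top,
    ← lintegral_add_compl _ (measurableSet_Ioi (a := (0:ℝ))), Set.compl_Ioi]
  rw [setLIntegral_congr_fun (g := fun y => ENNReal.ofReal (Real.exp (-α₂⁻¹ * y)) *
      gaussianPDF μ (σ ^ 2).toNNReal (-y + t)) measurableSet_Ioi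
      (fun y hy => by simp only [if_pos (Set.mem_Ioi.1 hy)]),
    setLIntegral_congr_fun (g := fun y => ENNReal.ofReal (Real.exp (α₁⁻¹ * y)) *
      gaussianPDF μ (σ ^ 2).toNNReal (-y + t)) measurableSet_Iic
      (fun y hy => by simp only [if_neg (not_lt.2 (Set.mem_Iic.1 hy))]),
    aux_set _ _ _ _ hσ, aux_set _ _ _ _ hσ, aux_gauss_Ioi _ _ hσ, aux_gauss_Iic _ _ hσ,
    ENNReal.ofReal_mul (by positivity), ENNReal.ofReal_add
      (mul_nonneg (Real.exp_pos _).le (hle _)) (mul_nonneg (Real.exp_pos _).le (hle _)),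
    ENNReal.ofReal_mul (Real.exp_pos _).le, ENNReal.ofReal_mul (Real.exp_pos _).le]
  have e1 : σ ^ 2 * (-α₂⁻¹) ^ 2 / 2 + -α₂⁻¹ * (t - μ) =
      (σ / (2 * α₂)) * (σ / α₂ - 2 * (t - μ) / σ) := by field_simp; ring
  have e2 : σ ^ 2 * α₁⁻¹ ^ 2 / 2 + α₁⁻¹ * (t - μ) =
      (σ / (2 * α₁)) * (σ / α₁ + 2 * (t - μ) / σ) := by field_simp
  have e3 : -(t - μ + σ ^ 2 * -α₂⁻¹) / σ = σ / α₂ - (t - μ) / σ := by field_simp; ring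
  have e4 : (t - μ + σ ^ 2 * α₁⁻¹) / σ = σ / α₁ + (t - μ) / σ := by field_simp; ring
  rw [e1, e2, e3, e4]
end

section
/- Let α₁, α₂ > 0, μ ∈ ℝ, σ > 0. The cumulative distribution function F of the Asymmetric Laplace–Gaussian distribution ALG(α₁, α₂, μ, σ) is given, for every t ∈ ℝ, by F(t) = (α₁⁻¹ + α₂⁻¹)⁻¹ · [ (α₁⁻¹ + α₂⁻¹) · Φ((t − μ)/σ) − α₁⁻¹ · exp( (σ/(2α₂)) · (σ/α₂ − 2(t − μ)/σ) ) · (1 − Φ(σ/α₂ − (t − μ)/σ)) + α₂⁻¹ · exp( (σ/(2α₁)) · (σ/α₁ + 2(t − μ)/σ) ) · (1 − Φ(σ/α₁ + (t − μ)/σ)) ], where Φ denotes the standard normal cumulative distribution function. -/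
open MeasureTheory ProbabilityTheory Real Filter

open scoped NNReal ENNReal

lemma conv_Iic_real (P Q : Measure ℝ) [IsProbabilityMeasure P] [IsProbabilityMeasure Q] (t : ℝ) :
    (P.conv Q).real (Set.Iic t) = ∫ y, P.real (Set.Iic (t - y)) ∂Q := by
  have hS : MeasurableSet ((fun x : ℝ × ℝ => x.1 + x.2) ⁻¹' Set.Iic t) :=
    measurableSet_Iic.preimage (by fun_prop)
  have h2 : ∀ y : ℝ, (fun x => (x, y)) ⁻¹' ((fun x : ℝ × ℝ => x.1 + x.2) ⁻¹' Set.Iic t)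
      = Set.Iic (t - y) := by
    intro y; ext x; simp [le_sub_iff_add_le]
  have h : (P.conv Q) (Set.Iic t) = ∫⁻ y, P (Set.Iic (t - y)) ∂Q := by
    rw [Measure.conv, Measure.map_apply (by fun_prop) measurableSet_Iic,
      Measure.prod_apply_symm hS]
    simp_rw [h2]
  have hm : Measurable fun y => P (Set.Iic (t - y)) := by
    have := measurable_measure_prodMk_right (μ := P) hS
    simpa only [h2] using this
  rw [measureReal_def, h]
  simp_rw [measureReal_def]
  rw [integral_toReal hm.aemeasurable]
  exact Filter.Eventually.of_forall fun y => measure_lt_top _ _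

lemma integral_expMeasure_eq {b : ℝ} (hb : 0 < b) (f : ℝ → ℝ) :
    ∫ y, f y ∂(expMeasure b) = ∫ y in Set.Ioi 0, b * rexp (-b * y) * f y := by
  have h : expMeasure b = volume.withDensity (exponentialPDF b) := rfl
  have hm : Measurable (exponentialPDF b) :=
    (measurable_exponentialPDFReal b).ennreal_ofReal
  rw [h, integral_withDensity_eq_integral_toReal_smul hm
    (Filter.Eventually.of_forall fun x => by simp [exponentialPDF]),
    ← integral_Ici_eq_integral_Ioi, ← integral_indicator measurableSet_Ici]
  congr 1
  ext y
  by_cases hy : 0 ≤ y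
  · rw [exponentialPDF_of_nonneg hy, ENNReal.toReal_ofReal (by positivity)]
    simp [hy]
  · rw [exponentialPDF_of_neg (not_le.mp hy)]
    simp [hy]

lemma expMeasure_neg_real {a : ℝ} (ha : 0 < a) (s : ℝ) :
    ((expMeasure a).map (fun x => -x)).real (Set.Iic s) = rexp (-a * max 0 (-s)) := by
  have := isProbabilityMeasure_expMeasure ha
  rw [measureReal_def, Measure.map_apply measurable_neg measurableSet_Iic, ← measureReal_def,
    ← integral_indicator_one (measurableSet_Iic.preimage measurable_neg),
    integral_expMeasure_eq ha]
  have h1 : ∀ y : ℝ, a * rexp (-a * y) * ((fun x : ℝ => -x) ⁻¹' Set.Iic s).indicator 1 y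
      = (Set.Ici (-s)).indicator (fun y => a * rexp (-a * y)) y := by
    intro y
    by_cases hy : -s ≤ y
    · simp [Set.indicator, hy, neg_le.mp hy]
    · have : ¬ (-y ≤ s) := fun h => hy (neg_le.mp h)
      simp [Set.indicator, hy, this]
  simp_rw [h1]
  rw [← integral_Ici_eq_integral_Ioi, setIntegral_indicator measurableSet_Ici, Set.Ici_inter_Ici,
    integral_Ici_eq_integral_Ioi, integral_const_mul, integral_exp_mul_Ioi (by linarith)]
  field_simp

lemma AL_cdf {a b : ℝ} (ha : 0 < a) (hb : 0 < b) (x : ℝ) :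
    ((expMeasure b).conv ((expMeasure a).map (fun x => -x))).real (Set.Iic x)
      = 1 - rexp (-b * max 0 x) + b / (a + b) * rexp (a * x - (a + b) * max 0 x) := by
  have := isProbabilityMeasure_expMeasure ha
  have := isProbabilityMeasure_expMeasure hb
  have : IsProbabilityMeasure ((expMeasure a).map (fun x => -x)) :=
    Measure.isProbabilityMeasure_map (by fun_prop)
  rw [Measure.conv_comm, conv_Iic_real, integral_expMeasure_eq hb]
  simp_rw [expMeasure_neg_real ha]
  set m := max 0 x with hm
  have i1 : ∀ c, IntegrableOn (fun y => b * rexp (-b * y)) (Set.Ioi c) := fun c =>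
    (integrableOn_exp_mul_Ioi (by linarith) c).const_mul b
  have i2 : IntegrableOn (fun y => b * rexp (a * x) * rexp (-(a + b) * y)) (Set.Ioi m) :=
    (integrableOn_exp_mul_Ioi (by linarith) m).const_mul _
  have i3 : IntegrableOn (fun y => b * rexp (-b * y) - b * rexp (a * x) * rexp (-(a + b) * y))
      (Set.Ioi m) := (i1 m).sub i2
  have h1 : ∀ y ∈ Set.Ioi (0 : ℝ), b * rexp (-b * y) * rexp (-a * max 0 (-(x - y)))
      = b * rexp (-b * y) - (Set.Ioi m).indicator
        (fun y => b * rexp (-b * y) - b * rexp (a * x) * rexp (-(a + b) * y)) y := by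
    intro y hy
    have hy : 0 < y := hy
    by_cases h : x < y
    · have : m < y := max_lt hy h
      rw [Set.indicator_of_mem (show y ∈ Set.Ioi m from this), max_eq_right (by linarith)]
      rw [mul_assoc, mul_assoc, ← Real.exp_add, ← Real.exp_add]
      ring_nf
    · have h' : ¬ m < y := fun h2 => h (lt_of_le_of_lt (le_max_right _ _) h2)
      rw [Set.indicator_of_notMem (show y ∉ Set.Ioi m from h'), max_eq_left (by linarith)]
      simp
  rw [setIntegral_congr_fun measurableSet_Ioi h1, integral_sub (i1 0)
    (i3.integrable_indicator measurableSet_Ioi).integrableOn,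
    setIntegral_indicator measurableSet_Ioi, Set.Ioi_inter_Ioi,
    sup_eq_right.mpr (le_max_left 0 x : (0:ℝ) ≤ m), integral_sub (i1 m) i2]
  simp_rw [integral_const_mul]
  rw [integral_exp_mul_Ioi (by linarith), integral_exp_mul_Ioi (by linarith),
    integral_exp_mul_Ioi (by linarith), sub_eq_add_neg (a * x), Real.exp_add, ← neg_mul]
  have : a + b ≠ 0 := by positivity
  simp only [mul_zero, Real.exp_zero]
  field_simp
  ring

lemma gaussian_tilt {μ c : ℝ} {v : ℝ≥0} (hv : v ≠ 0) {S : Set ℝ} (hS : MeasurableSet S) :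
    ∫ x in S, rexp (c * x) ∂(gaussianReal μ v)
      = rexp (c * μ + c ^ 2 * v / 2) * (gaussianReal (μ + c * v) v).real S := by
  rw [measureReal_def, gaussianReal_apply_eq_integral _ hv, ENNReal.toReal_ofReal
    (integral_nonneg fun x => gaussianPDFReal_nonneg _ _ _), ← integral_const_mul,
    ← integral_indicator hS, integral_gaussianReal_eq_integral_smul hv, ← integral_indicator hS]
  congr 1
  ext x
  by_cases hx : x ∈ S
  · simp only [Set.indicator_of_mem hx, gaussianPDFReal, smul_eq_mul]
    have hv' : (v : ℝ) ≠ 0 := by exact_mod_cast hv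
    rw [mul_assoc, ← Real.exp_add, mul_left_comm, ← Real.exp_add]
    congr 2
    field_simp
    ring
  · simp [hx]

lemma gaussian_Iic {m σ : ℝ} (hσ : 0 < σ) (t : ℝ) :
    (gaussianReal m (σ ^ 2).toNNReal).real (Set.Iic t) = stdNormCDF ((t - m) / σ) := by
  have h : gaussianReal m (σ ^ 2).toNNReal = (gaussianReal 0 1).map (fun x => m + σ * x) := by
    have : (fun x => m + σ * x) = (fun x => m + x) ∘ (fun x => σ * x) := rfl
    rw [this, ← Measure.map_map (by fun_prop) (by fun_prop), gaussianReal_map_const_mul,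
      gaussianReal_map_const_add]
    congr 1
    · simp
    · ext; simp [sq_nonneg]
  rw [measureReal_def, h, Measure.map_apply (by fun_prop) measurableSet_Iic, stdNormCDF]
  congr 2
  ext x
  simp only [Set.mem_preimage, Set.mem_Iic]
  rw [le_div_iff₀ hσ]
  constructor <;> intro h <;> linarith

lemma gaussian_Ioi {m σ : ℝ} (hσ : 0 < σ) (t : ℝ) :
    (gaussianReal m (σ ^ 2).toNNReal).real (Set.Ioi t) = 1 - stdNormCDF ((t - m) / σ) := by
  rw [← gaussian_Iic hσ, ← Set.compl_Iic, probReal_compl_eq_one_sub measurableSet_Iic]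

lemma stdNormCDF_neg (x : ℝ) : 1 - stdNormCDF (-x) = stdNormCDF x := by
  have := nullSingletonClass_gaussianReal (μ := 0) (v := 1) one_ne_zero
  have h : (gaussianReal 0 1).map (fun x => -x) = gaussianReal 0 1 := by
    rw [gaussianReal_map_neg, neg_zero]
  have h2 : stdNormCDF x = (gaussianReal 0 1).real (Set.Ioi (-x)) := by
    rw [stdNormCDF, ← h, Measure.map_apply measurable_neg measurableSet_Iic, h,
      measureReal_def]
    have : (fun x : ℝ => -x) ⁻¹' Set.Iic x = Set.Ici (-x) := by
      ext y; simp [neg_le]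
    rw [this, measure_congr Ioi_ae_eq_Ici]
  rw [h2, ← Set.compl_Iic, probReal_compl_eq_one_sub measurableSet_Iic]
  rfl

/-- the cumulative distribution function of `ALG(α₁, α₂, μ, σ)` has the stated
closed form in terms of the standard normal CDF `Φ`. -/
theorem ALG_cdf (α₁ α₂ μ σ : ℝ) (hα₁ : 0 < α₁) (hα₂ : 0 < α₂) (hσ : 0 < σ) :
    ∀ t : ℝ, ((ALG α₁ α₂ μ σ) (Set.Iic t)).toReal
      = (α₁⁻¹ + α₂⁻¹)⁻¹ *
        ((α₁⁻¹ + α₂⁻¹) * stdNormCDF ((t - μ) / σ)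
          - α₁⁻¹ * Real.exp ((σ / (2 * α₂)) * (σ / α₂ - 2 * (t - μ) / σ)) *
              (1 - stdNormCDF (σ / α₂ - (t - μ) / σ))
          + α₂⁻¹ * Real.exp ((σ / (2 * α₁)) * (σ / α₁ + 2 * (t - μ) / σ)) *
              (1 - stdNormCDF (σ / α₁ + (t - μ) / σ))) := by
  intro t
  obtain ⟨a, rfl⟩ : ∃ a, α₁ = a⁻¹ := ⟨α₁⁻¹, by simp⟩
  obtain ⟨b, rfl⟩ : ∃ b, α₂ = b⁻¹ := ⟨α₂⁻¹, by simp⟩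
  have ha : 0 < a := inv_pos.mp hα₁
  have hb : 0 < b := inv_pos.mp hα₂
  have hab : a + b ≠ 0 := by positivity
  have hv : (σ ^ 2).toNNReal ≠ 0 := by
    have : 0 < (σ ^ 2).toNNReal := Real.toNNReal_pos.mpr (by positivity)
    exact this.ne'
  have hvc : ((σ ^ 2).toNNReal : ℝ) = σ ^ 2 := Real.coe_toNNReal _ (sq_nonneg σ)
  have := isProbabilityMeasure_expMeasure ha
  have := isProbabilityMeasure_expMeasure hb
  have : IsProbabilityMeasure ((expMeasure a).map (fun x => -x)) :=
    Measure.isProbabilityMeasure_map (by fun_prop)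
  rw [← measureReal_def, ALG, AL]
  simp only [inv_inv]
  rw [conv_Iic_real]
  simp_rw [AL_cdf ha hb]
  set G := gaussianReal μ (σ ^ 2).toNNReal with hG
  have i0 : ∀ c, Integrable (fun n => rexp (c * n)) G := fun c =>
    integrable_exp_mul_gaussianReal c
  have i1 : Integrable (fun n => a / (a + b) * rexp (-b * t) * rexp (b * n)) G :=
    (i0 b).const_mul _
  have i2 : Integrable (fun n => b / (a + b) * rexp (a * t) * rexp (-a * n)) G :=
    (i0 (-a)).const_mul _
  have i3 : Integrable (fun n => 1 - a / (a + b) * rexp (-b * t) * rexp (b * n)) G :=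
    (integrable_const 1).sub i1
  have h1 : ∀ n, 1 - rexp (-b * max 0 (t - n))
        + b / (a + b) * rexp (a * (t - n) - (a + b) * max 0 (t - n))
      = (Set.Iic t).indicator (fun n => 1 - a / (a + b) * rexp (-b * t) * rexp (b * n)) n
        + (Set.Ioi t).indicator (fun n => b / (a + b) * rexp (a * t) * rexp (-a * n)) n := by
    intro n
    by_cases h : n ≤ t
    · rw [Set.indicator_of_mem (show n ∈ Set.Iic t from h),
        Set.indicator_of_notMem (show n ∉ Set.Ioi t from not_lt.mpr h),
        max_eq_right (by linarith), mul_assoc, ← Real.exp_add]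
      have e1 : a * (t - n) - (a + b) * (t - n) = -b * t + b * n := by ring
      have e2 : -b * (t - n) = -b * t + b * n := by ring
      rw [e1, e2]
      field_simp
      ring
    · have h' : t < n := not_le.mp h
      rw [Set.indicator_of_notMem (show n ∉ Set.Iic t from h),
        Set.indicator_of_mem (show n ∈ Set.Ioi t from h'),
        max_eq_left (by linarith), mul_assoc, ← Real.exp_add]
      have e1 : a * (t - n) - (a + b) * 0 = a * t + -a * n := by ring
      rw [e1]
      simp
  simp_rw [h1]
  rw [integral_add (i3.indicator measurableSet_Iic)
    (i2.indicator measurableSet_Ioi), integral_indicator measurableSet_Iic,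
    integral_indicator measurableSet_Ioi,
    integral_sub (integrable_const 1).integrableOn i1.integrableOn]
  simp_rw [integral_const_mul]
  rw [hG, gaussian_tilt hv measurableSet_Iic, gaussian_tilt hv measurableSet_Ioi,
    gaussian_Iic hσ, gaussian_Ioi hσ, setIntegral_const, gaussian_Iic hσ, hvc]
  have z1 : σ / b⁻¹ - (t - μ) / σ = -((t - (μ + b * σ ^ 2)) / σ) := by field_simp; ring
  have z2 : σ / a⁻¹ + (t - μ) / σ = (t - (μ + -a * σ ^ 2)) / σ := by field_simp; ring
  rw [z1, stdNormCDF_neg, z2]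
  have x1 : rexp (σ / (2 * b⁻¹) * (σ / b⁻¹ - 2 * (t - μ) / σ))
      = rexp (-b * t) * rexp (b * μ + b ^ 2 * σ ^ 2 / 2) := by
    rw [← Real.exp_add]; congr 1; field_simp; ring
  have x2 : rexp (σ / (2 * a⁻¹) * (σ / a⁻¹ + 2 * (t - μ) / σ))
      = rexp (a * t) * rexp (-a * μ + (-a) ^ 2 * σ ^ 2 / 2) := by
    rw [← Real.exp_add]; congr 1; field_simp; ring
  rw [x1, x2, smul_eq_mul]
  field_simp
end

section
/- Let α₁, α₂ > 0, μ ∈ ℝ, σ > 0, and let Z be a random variable with the Asymmetric Laplace–Gaussian distribution ALG(α₁, α₂, μ, σ). Then the third central moment of Z satisfies E[(Z − E[Z])³] = 2(α₂³ − α₁³); consequently the skewness of Z equals 2(α₂³ − α₁³)/(α₁² + α₂² + σ²)^(3/2). -/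
open MeasureTheory ProbabilityTheory Real Filter

lemma integrable_fun_sub_aux {Ω : Type*} [MeasurableSpace Ω] {P : Measure Ω} {f g : Ω → ℝ}
    (hf : Integrable f P) (hg : Integrable g P) : Integrable (fun x => f x - g x) P :=
  hf.sub hg

/-- Cumulant data up to order three for a probability measure on `ℝ`. -/
structure HasCum (ν : Measure ℝ) (m v k : ℝ) : Prop where
  prob : IsProbabilityMeasure ν
  i1 : Integrable (fun x : ℝ => x) ν
  i2 : Integrable (fun x : ℝ => x ^ 2) ν
  i3 : Integrable (fun x : ℝ => x ^ 3) ν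
  e1 : ∫ x, x ∂ν = m
  e2 : ∫ x, x ^ 2 ∂ν = v + m ^ 2
  e3 : ∫ x, x ^ 3 ∂ν = k + 3 * m * v + m ^ 3

lemma HasCum.conv {ν₁ ν₂ : Measure ℝ} {m₁ v₁ k₁ m₂ v₂ k₂ : ℝ}
    (h₁ : HasCum ν₁ m₁ v₁ k₁) (h₂ : HasCum ν₂ m₂ v₂ k₂) :
    HasCum (ν₁.conv ν₂) (m₁ + m₂) (v₁ + v₂) (k₁ + k₂) := by
  have := h₁.prob
  have := h₂.prob
  have c1 := integrable_const (μ := ν₁) (1 : ℝ)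
  have c2 := integrable_const (μ := ν₂) (1 : ℝ)
  have j10 := h₁.i1.mul_prod c2
  have j01 := c1.mul_prod h₂.i1
  have j20 := h₁.i2.mul_prod c2
  have j11 := (h₁.i1.mul_prod h₂.i1).const_mul 2
  have j02 := c1.mul_prod h₂.i2
  have j30 := h₁.i3.mul_prod c2
  have j21 := (h₁.i2.mul_prod h₂.i1).const_mul 3
  have j12 := (h₁.i1.mul_prod h₂.i2).const_mul 3
  have j03 := c1.mul_prod h₂.i3
  have q1 : (fun z : ℝ × ℝ => z.1 + z.2) = fun z => z.1 * 1 + 1 * z.2 := by ext; ring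
  have q2 : (fun z : ℝ × ℝ => (z.1 + z.2) ^ 2) =
      fun z => z.1 ^ 2 * 1 + 2 * (z.1 * z.2) + 1 * z.2 ^ 2 := by ext; ring
  have q3 : (fun z : ℝ × ℝ => (z.1 + z.2) ^ 3) =
      fun z => z.1 ^ 3 * 1 + 3 * (z.1 ^ 2 * z.2) + 3 * (z.1 * z.2 ^ 2) + 1 * z.2 ^ 3 := by
    ext; ring
  have hm : AEMeasurable (fun z : ℝ × ℝ => z.1 + z.2) (ν₁.prod ν₂) := by fun_prop
  refine ⟨inferInstance, ?_, ?_, ?_, ?_, ?_, ?_⟩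
  · rw [Measure.conv, integrable_map_measure (by fun_prop) hm]
    change Integrable (fun z : ℝ × ℝ => z.1 + z.2) _
    rw [q1]; exact j10.add j01
  · rw [Measure.conv, integrable_map_measure (by fun_prop) hm]
    change Integrable (fun z : ℝ × ℝ => (z.1 + z.2) ^ 2) _
    rw [q2]; exact (j20.add j11).add j02
  · rw [Measure.conv, integrable_map_measure (by fun_prop) hm]
    change Integrable (fun z : ℝ × ℝ => (z.1 + z.2) ^ 3) _
    rw [q3]; exact ((j30.add j21).add j12).add j03
  · rw [Measure.conv, integral_map hm (by fun_prop), q1, integral_add j10 j01,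
      integral_prod_mul (fun x : ℝ => x) (fun _ : ℝ => (1 : ℝ)),
      integral_prod_mul (fun _ : ℝ => (1 : ℝ)) (fun x : ℝ => x), h₁.e1, h₂.e1]
    simp
  · rw [Measure.conv, integral_map hm (by fun_prop), q2, integral_add (j20.fun_add j11) j02,
      integral_add j20 j11, integral_const_mul,
      integral_prod_mul (fun x : ℝ => x ^ 2) (fun _ : ℝ => (1 : ℝ)),
      integral_prod_mul (fun x : ℝ => x) (fun x : ℝ => x),
      integral_prod_mul (fun _ : ℝ => (1 : ℝ)) (fun x : ℝ => x ^ 2),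
      h₁.e1, h₂.e1, h₁.e2, h₂.e2]
    simp
    ring
  · rw [Measure.conv, integral_map hm (by fun_prop), q3,
      integral_add ((j30.fun_add j21).fun_add j12) j03, integral_add (j30.fun_add j21) j12,
      integral_add j30 j21, integral_const_mul, integral_const_mul,
      integral_prod_mul (fun x : ℝ => x ^ 3) (fun _ : ℝ => (1 : ℝ)),
      integral_prod_mul (fun x : ℝ => x ^ 2) (fun x : ℝ => x),
      integral_prod_mul (fun x : ℝ => x) (fun x : ℝ => x ^ 2),
      integral_prod_mul (fun _ : ℝ => (1 : ℝ)) (fun x : ℝ => x ^ 3),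
      h₁.e1, h₂.e1, h₁.e2, h₂.e2, h₁.e3, h₂.e3]
    simp
    ring

lemma HasCum.neg {ν : Measure ℝ} {m v k : ℝ} (h : HasCum ν m v k) :
    HasCum (ν.map (fun x => -x)) (-m) v (-k) := by
  have := h.prob
  have hm : AEMeasurable (fun x : ℝ => -x) ν := by fun_prop
  have q2 : ∀ x : ℝ, (-x) ^ 2 = x ^ 2 := fun x => by ring
  have q3 : ∀ x : ℝ, (-x) ^ 3 = -x ^ 3 := fun x => by ring
  refine ⟨Measure.isProbabilityMeasure_map hm, ?_, ?_, ?_, ?_, ?_, ?_⟩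
  · rw [integrable_map_measure (by fun_prop) hm]
    exact h.i1.neg
  · rw [integrable_map_measure (by fun_prop) hm]
    simpa only [Function.comp_def, q2] using h.i2
  · rw [integrable_map_measure (by fun_prop) hm]
    simpa only [Function.comp_def, q3] using h.i3.fun_neg
  · rw [integral_map hm (by fun_prop), integral_neg, h.e1]
  · rw [integral_map hm (by fun_prop)]
    simp only [q2]
    rw [h.e2]
  · rw [integral_map hm (by fun_prop)]
    simp only [q3]
    rw [integral_neg, h.e3]
    ring

lemma expMeasure_moment {r : ℝ} (hr : 0 < r) (n : ℕ) :
    Integrable (fun x : ℝ => x ^ n) (expMeasure r) ∧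
      ∫ x, x ^ n ∂(expMeasure r) = n.factorial / r ^ n := by
  have key : ∫ x, x ^ n ∂(expMeasure r) = n.factorial / r ^ n := by
    have hmeas : Measurable (exponentialPDF r) :=
      (measurable_exponentialPDFReal r).ennreal_ofReal
    change ∫ x, x ^ n ∂(volume.withDensity (exponentialPDF r)) = _
    rw [integral_withDensity_eq_integral_toReal_smul hmeas
      (ae_of_all _ fun x => by simp [exponentialPDF_eq])]
    have h1 : (fun x : ℝ => (exponentialPDF r x).toReal • x ^ n) =
        (Set.Ici (0 : ℝ)).indicator (fun x => r * (x ^ (((n : ℝ) + 1) - 1) * exp (-(r * x)))) := by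
      ext x
      by_cases hx : 0 ≤ x
      · rw [Set.indicator_of_mem (show x ∈ Set.Ici (0 : ℝ) from hx), exponentialPDF_of_nonneg hx,
          ENNReal.toReal_ofReal (by positivity), add_sub_cancel_right, rpow_natCast, smul_eq_mul]
        ring
      · rw [Set.indicator_of_notMem (show x ∉ Set.Ici (0 : ℝ) from hx),
          exponentialPDF_of_neg (not_le.mp hx)]
        simp
    rw [h1, integral_indicator measurableSet_Ici, integral_Ici_eq_integral_Ioi,
      integral_const_mul, integral_rpow_mul_exp_neg_mul_Ioi (by positivity) hr,
      Real.Gamma_nat_eq_factorial, show ((n : ℝ) + 1) = ((n + 1 : ℕ) : ℝ) by push_cast; rfl,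
      rpow_natCast, one_div, inv_pow]
    field_simp
    ring
  refine ⟨?_, key⟩
  by_contra hc
  rw [integral_undef hc] at key
  have : (0 : ℝ) < n.factorial / r ^ n := by positivity
  linarith

lemma hasCum_exp {a : ℝ} (ha : 0 < a) : HasCum (expMeasure a⁻¹) a (a ^ 2) (2 * a ^ 3) := by
  have hr : 0 < a⁻¹ := by positivity
  have h1 := expMeasure_moment hr 1
  have h2 := expMeasure_moment hr 2
  have h3 := expMeasure_moment hr 3
  simp only [pow_one] at h1
  refine ⟨isProbabilityMeasure_expMeasure hr, h1.1, h2.1, h3.1, ?_, ?_, ?_⟩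
  · rw [h1.2]; simp
  · rw [h2.2]; simp [Nat.factorial]; ring
  · rw [h3.2]; simp [Nat.factorial]; ring

lemma hasCum_gaussian (μ : ℝ) (v : NNReal) : HasCum (gaussianReal μ v) μ v 0 := by
  have L : ∀ n : ℕ, Integrable (fun x : ℝ => x ^ n) (gaussianReal μ v) := fun n =>
    integrable_pow_of_mem_interior_integrableExpSet (X := fun x => x) (by simp) n
  have i1 : Integrable (fun x : ℝ => x) (gaussianReal μ v) := by simpa using L 1
  have e1 : ∫ x, x ∂(gaussianReal μ v) = μ := integral_id_gaussianReal
  have e2 : ∫ x, x ^ 2 ∂(gaussianReal μ v) = v + μ ^ 2 := by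
    have h := variance_eq_sub (memLp_id_gaussianReal (μ := μ) (v := v) 2)
    rw [variance_id_gaussianReal] at h
    simp only [Pi.pow_apply, id] at h
    rw [e1] at h
    linarith
  refine ⟨inferInstance, i1, L 2, L 3, e1, e2, ?_⟩
  have hs : ∫ x, x ^ 3 ∂(gaussianReal μ v) = ∫ x, (2 * μ - x) ^ 3 ∂(gaussianReal μ v) := by
    have h := gaussianReal_map_const_sub (μ := μ) (v := v) (2 * μ)
    rw [show 2 * μ - μ = μ by ring] at h
    conv_lhs => rw [← h]
    rw [integral_map (by fun_prop) (by fun_prop)]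
  have q : (fun x : ℝ => (2 * μ - x) ^ 3) =
      fun x => 8 * μ ^ 3 - 12 * μ ^ 2 * x + 6 * μ * x ^ 2 - x ^ 3 := by ext; ring
  have c := integrable_const (μ := gaussianReal μ v) (8 * μ ^ 3)
  have t1 := i1.const_mul (12 * μ ^ 2)
  have t2 := (L 2).const_mul (6 * μ)
  rw [q, integral_sub ((integrable_fun_sub_aux c t1).fun_add t2) (L 3), integral_add (integrable_fun_sub_aux c t1) t2, integral_sub c t1,
    integral_const_mul, integral_const_mul, integral_const_mul, e1, e2] at hs
  simp at hs
  linarith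

/-- if `Z ~ ALG(α₁, α₂, μ, σ)` then the third central moment of `Z` is
`2(α₂³ - α₁³)`, so the skewness of `Z` is `2(α₂³ - α₁³)/(α₁² + α₂² + σ²)^(3/2)`. -/
theorem ALG_third_central_moment_skewness {Ω : Type*} [MeasurableSpace Ω]
    (P : Measure Ω) [IsProbabilityMeasure P]
    (α₁ α₂ μ σ : ℝ) (hα₁ : 0 < α₁) (hα₂ : 0 < α₂) (hσ : 0 < σ)
    (Z : Ω → ℝ) (hZ : Measurable Z) (hlawZ : P.map Z = ALG α₁ α₂ μ σ) :
    (∫ ω, (Z ω - ∫ ω', Z ω' ∂P) ^ 3 ∂P) = 2 * (α₂ ^ 3 - α₁ ^ 3) ∧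
    (∫ ω, (Z ω - ∫ ω', Z ω' ∂P) ^ 3 ∂P) / (variance Z P) ^ ((3 : ℝ) / 2)
      = 2 * (α₂ ^ 3 - α₁ ^ 3) / (α₁ ^ 2 + α₂ ^ 2 + σ ^ 2) ^ ((3 : ℝ) / 2) := by
  have hc : HasCum (P.map Z) (α₂ + -α₁ + μ) (α₂ ^ 2 + α₁ ^ 2 + ((σ ^ 2).toNNReal : ℝ))
      (2 * α₂ ^ 3 + -(2 * α₁ ^ 3) + 0) := by
    rw [hlawZ]
    exact ((hasCum_exp hα₂).conv (hasCum_exp hα₁).neg).conv (hasCum_gaussian μ _)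
  rw [Real.coe_toNNReal _ (sq_nonneg σ)] at hc
  set m := α₂ + -α₁ + μ with hm
  have i1 : Integrable Z P := hc.i1.comp_measurable hZ
  have i2 : Integrable (fun ω => Z ω ^ 2) P := hc.i2.comp_measurable hZ
  have i3 : Integrable (fun ω => Z ω ^ 3) P := hc.i3.comp_measurable hZ
  have e1 := hc.e1
  have e2 := hc.e2
  have e3 := hc.e3
  rw [integral_map hZ.aemeasurable (by fun_prop)] at e1 e2 e3
  have hvar : variance Z P = α₁ ^ 2 + α₂ ^ 2 + σ ^ 2 := by
    have q : (fun ω => (Z ω - m) ^ 2) = fun ω => Z ω ^ 2 - 2 * m * Z ω + m ^ 2 := by ext; ring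
    have t1 := i1.const_mul (2 * m)
    rw [variance_eq_integral hZ.aemeasurable, e1, q,
      integral_add (integrable_fun_sub_aux i2 t1) (integrable_const _), integral_sub i2 t1, integral_const_mul, e1, e2]
    simp
    ring
  have hthird : (∫ ω, (Z ω - ∫ ω', Z ω' ∂P) ^ 3 ∂P) = 2 * (α₂ ^ 3 - α₁ ^ 3) := by
    have q : (fun ω => (Z ω - m) ^ 3) =
        fun ω => Z ω ^ 3 - 3 * m * Z ω ^ 2 + 3 * m ^ 2 * Z ω - m ^ 3 := by ext; ring
    have t1 := i1.const_mul (3 * m ^ 2)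
    have t2 := i2.const_mul (3 * m)
    rw [e1, q, integral_sub ((integrable_fun_sub_aux i3 t2).fun_add t1) (integrable_const _),
      integral_add (integrable_fun_sub_aux i3 t2) t1, integral_sub i3 t2, integral_const_mul, integral_const_mul,
      e1, e2, e3]
    simp
    ring
  exact ⟨hthird, by rw [hthird, hvar]⟩
end

section
/- Let α₁, α₂ > 0, μ ∈ ℝ, σ > 0, and let f denote the density of the Asymmetric Laplace–Gaussian distribution ALG(α₁, α₂, μ, σ) with respect to Lebesgue measure. Then f is infinitely differentiable on ℝ, and its right tail is proportionate to the exponential density with mean α₂: lim_{t → ∞} f(t) · exp((t − μ)/α₂) = (α₁ + α₂)⁻¹ · exp(σ²/(2α₂²)). -/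
open MeasureTheory ProbabilityTheory Real Filter

lemma stdNormCDF_eq (x : ℝ) : stdNormCDF x =
    stdNormCDF 0 + ∫ y in (0:ℝ)..x, gaussianPDFReal 0 1 y := by
  have h : ∀ x, stdNormCDF x = ∫ y in Set.Iic x, gaussianPDFReal 0 1 y := by
    intro x
    unfold stdNormCDF
    rw [gaussianReal_apply_eq_integral _ one_ne_zero, ENNReal.toReal_ofReal]
    exact integral_nonneg (fun y => gaussianPDFReal_nonneg 0 1 y)
  rw [h x, h 0, ← intervalIntegral.integral_Iic_sub_Iic
    (integrable_gaussianPDFReal 0 1).integrableOn (integrable_gaussianPDFReal 0 1).integrableOn]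
  ring

lemma contDiff_pdf : ContDiff ℝ (⊤ : ℕ∞) (gaussianPDFReal 0 1) := by
  unfold gaussianPDFReal
  fun_prop

lemma contDiff_stdNormCDF : ContDiff ℝ (⊤ : ℕ∞) stdNormCDF := by
  have hd : ∀ x, HasDerivAt stdNormCDF (gaussianPDFReal 0 1 x) x := by
    intro x
    have hc : Continuous (gaussianPDFReal 0 1) := contDiff_pdf.continuous
    rw [funext stdNormCDF_eq]
    exact (hc.integral_hasStrictDerivAt 0 x).hasDerivAt.const_add _
  rw [contDiff_infty_iff_deriv]
  refine ⟨fun x => (hd x).differentiableAt, ?_⟩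
  rw [funext fun x => (hd x).deriv]
  exact contDiff_pdf

lemma one_sub_eq (x : ℝ) : 1 - stdNormCDF x = (gaussianReal 0 1).real (Set.Ioi x) := by
  have := probReal_compl_eq_one_sub (μ := gaussianReal 0 1) (measurableSet_Iic (a := x))
  rw [Set.compl_Iic] at this
  rw [this]; rfl

lemma tail_bound (k x : ℝ) (hk : 0 ≤ k) :
    1 - stdNormCDF x ≤ Real.exp (-k * x) * Real.exp (k ^ 2 / 2) := by
  rw [one_sub_eq]
  have h := measure_ge_le_exp_mul_mgf (μ := gaussianReal 0 1) (X := id) x hk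
    (integrable_exp_mul_gaussianReal k)
  rw [mgf_id_gaussianReal] at h
  have hsub : Set.Ioi x ⊆ {ω : ℝ | x ≤ id ω} := by
    intro y hy
    simpa using (Set.mem_Ioi.mp hy).le
  refine (measureReal_mono hsub).trans (h.trans (le_of_eq ?_))
  simp

lemma tail_nonneg (x : ℝ) : 0 ≤ 1 - stdNormCDF x := by
  rw [one_sub_eq]; exact measureReal_nonneg

lemma tendsto_tail (k : ℝ) (hk : 0 ≤ k) :
    Tendsto (fun x => Real.exp (k * x) * (1 - stdNormCDF x)) atTop (nhds 0) := by
  have h1 : Tendsto (fun x : ℝ => Real.exp ((k + 1) ^ 2 / 2) * Real.exp (-x)) atTop (nhds 0) := by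
    simpa using (Real.tendsto_exp_neg_atTop_nhds_zero).const_mul (Real.exp ((k + 1) ^ 2 / 2))
  refine squeeze_zero (fun x => mul_nonneg (Real.exp_pos _).le (tail_nonneg x)) (fun x => ?_) h1
  refine (mul_le_mul_of_nonneg_left (tail_bound (k + 1) x (by linarith))
    (Real.exp_pos _).le).trans (le_of_eq ?_)
  rw [← Real.exp_add, ← Real.exp_add, ← Real.exp_add]
  ring_nf

lemma tendsto_stdNormCDF_atBot : Tendsto stdNormCDF atBot (nhds 0) := by
  have : stdNormCDF = fun x => cdf (gaussianReal 0 1) x := by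
    funext x
    rw [cdf_eq_real]; rfl
  rw [this]
  exact tendsto_cdf_atBot _

/-- Shape and Tail Behavior: the density `f` of `ALG(α₁, α₂, μ, σ)` is infinitely
differentiable on `ℝ`, and its right tail is proportionate to the exponential density with mean
`α₂`: `f(t)·exp((t - μ)/α₂) → (α₁ + α₂)⁻¹·exp(σ²/(2α₂²))` as `t → ∞`. -/
theorem ALG_density_smooth_and_tail (α₁ α₂ μ σ : ℝ)
    (hα₁ : 0 < α₁) (hα₂ : 0 < α₂) (hσ : 0 < σ)
    (f : ℝ → ℝ)
    (hf : f = fun t => (α₁ + α₂)⁻¹ *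
      (Real.exp ((σ / (2 * α₂)) * (σ / α₂ - 2 * (t - μ) / σ)) *
          (1 - stdNormCDF (σ / α₂ - (t - μ) / σ)) +
       Real.exp ((σ / (2 * α₁)) * (σ / α₁ + 2 * (t - μ) / σ)) *
          (1 - stdNormCDF (σ / α₁ + (t - μ) / σ)))) :
    ContDiff ℝ (⊤ : ℕ∞) f ∧
    Tendsto (fun t => f t * Real.exp ((t - μ) / α₂)) atTop
      (nhds ((α₁ + α₂)⁻¹ * Real.exp (σ ^ 2 / (2 * α₂ ^ 2)))) := by
  have hα₁' := hα₁.ne'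
  have hα₂' := hα₂.ne'
  have hσ' := hσ.ne'
  subst hf
  have hΦ := contDiff_stdNormCDF
  constructor
  · have h1 : ContDiff ℝ (⊤ : ℕ∞) (fun t => stdNormCDF (σ / α₂ - (t - μ) / σ)) :=
      hΦ.comp (by fun_prop)
    have h2 : ContDiff ℝ (⊤ : ℕ∞) (fun t => stdNormCDF (σ / α₁ + (t - μ) / σ)) :=
      hΦ.comp (by fun_prop)
    fun_prop
  · have hs : Tendsto (fun t : ℝ => (t - μ) / σ) atTop atTop :=
      (tendsto_atTop_add_const_right _ (-μ) tendsto_id).atTop_div_const hσ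
    have hA : Tendsto (fun t : ℝ => 1 - stdNormCDF (σ / α₂ - (t - μ) / σ)) atTop (nhds 1) := by
      have : Tendsto (fun t : ℝ => σ / α₂ - (t - μ) / σ) atTop atBot :=
        tendsto_atBot_add_const_left _ _ (tendsto_neg_atTop_atBot.comp hs)
      simpa using (tendsto_stdNormCDF_atBot.comp this).const_sub 1
    have hB := (tendsto_tail (σ / α₁ + σ / α₂) (by positivity)).comp
      (tendsto_atTop_add_const_left _ (σ / α₁) hs)
    have hC := ((hA.const_mul (Real.exp (σ ^ 2 / (2 * α₂ ^ 2)))).add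
      (hB.const_mul (Real.exp (σ ^ 2 / (2 * α₁ ^ 2) - (σ / α₁ + σ / α₂) * (σ / α₁))))).const_mul
        (α₁ + α₂)⁻¹
    simp only [mul_one, mul_zero, add_zero] at hC
    refine hC.congr (fun t => ?_)
    simp only [Function.comp]
    have e1 : Real.exp (σ ^ 2 / (2 * α₂ ^ 2)) =
        Real.exp ((σ / (2 * α₂)) * (σ / α₂ - 2 * (t - μ) / σ)) * Real.exp ((t - μ) / α₂) := by
      rw [← Real.exp_add]
      congr 1
      field_simp
      ring
    have e2 : Real.exp (σ ^ 2 / (2 * α₁ ^ 2) - (σ / α₁ + σ / α₂) * (σ / α₁)) *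
        Real.exp ((σ / α₁ + σ / α₂) * (σ / α₁ + (t - μ) / σ)) =
        Real.exp ((σ / (2 * α₁)) * (σ / α₁ + 2 * (t - μ) / σ)) * Real.exp ((t - μ) / α₂) := by
      rw [← Real.exp_add, ← Real.exp_add]
      congr 1
      field_simp
      ring
    rw [← mul_assoc (Real.exp (_ - _)), e1, e2]
    ring
end

section
/- Let α₁, α₂ > 0, μ ∈ ℝ, σ > 0, let f and F denote the density and the cumulative distribution function of the Asymmetric Laplace–Gaussian distribution ALG(α₁, α₂, μ, σ). Then the hazard function h(t) = f(t)/(1 − F(t)) is strictly increasing on ℝ (in particular F(t) < 1 for every t ∈ ℝ, so h is well defined everywhere). -/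
open MeasureTheory ProbabilityTheory Real Filter

namespace ALGaux

/-- standard normal density -/
noncomputable def ph (x : ℝ) : ℝ := gaussianPDFReal 0 1 x

/-- standard normal tail -/
noncomputable def Q (x : ℝ) : ℝ := 1 - stdNormCDF x

lemma ph_eq (x : ℝ) : ph x = (√(2 * π))⁻¹ * Real.exp (-x ^ 2 / 2) := by
  simp [ph, gaussianPDFReal]

lemma ph_pos (x : ℝ) : 0 < ph x := gaussianPDFReal_pos _ _ _ one_ne_zero

lemma ph_shift (x a : ℝ) : Real.exp (a ^ 2 / 2 + a * x) * ph (a + x) = ph x := by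
  rw [ph_eq, ph_eq, mul_left_comm, ← Real.exp_add]
  congr 2
  ring

lemma ph_neg (x : ℝ) : ph (-x) = ph x := by
  rw [ph_eq, ph_eq, neg_sq]

lemma hasDerivAt_ph (x : ℝ) : HasDerivAt ph (-x * ph x) x := by
  have h : HasDerivAt (fun x : ℝ => (√(2 * π))⁻¹ * Real.exp (-x ^ 2 / 2))
      ((√(2 * π))⁻¹ * (Real.exp (-x ^ 2 / 2) * (-(2 * x) / 2))) x := by
    have h1 : HasDerivAt (fun x : ℝ => -x ^ 2 / 2) (-(2 * x) / 2) x := by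
      have := ((hasDerivAt_pow 2 x).neg).div_const 2
      simpa using this
    exact (h1.exp).const_mul _
  have e : ph = fun x : ℝ => (√(2 * π))⁻¹ * Real.exp (-x ^ 2 / 2) := funext ph_eq
  rw [e]
  convert h using 1
  ring

lemma cont_ph : Continuous ph :=
  continuous_iff_continuousAt.2 fun x => (hasDerivAt_ph x).continuousAt

lemma int_ph : Integrable ph := integrable_gaussianPDFReal 0 1

lemma cdf_eq (x : ℝ) : stdNormCDF x = ∫ y in Set.Iic x, ph y := by
  rw [stdNormCDF, gaussianReal_apply_eq_integral _ one_ne_zero, ENNReal.toReal_ofReal]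
  · rfl
  · exact integral_nonneg fun y => (ph_pos y).le

lemma hasDerivAt_Q (x : ℝ) : HasDerivAt Q (-ph x) x := by
  have e : Q = fun y => Q 0 - ∫ u in (0:ℝ)..y, ph u := by
    funext y
    rw [← intervalIntegral.integral_Iic_sub_Iic int_ph.integrableOn int_ph.integrableOn,
      ← cdf_eq, ← cdf_eq]
    simp only [Q]; ring
  rw [e]
  exact (intervalIntegral.integral_hasDerivAt_right (int_ph.intervalIntegrable)
    (cont_ph.stronglyMeasurableAtFilter _ _) cont_ph.continuousAt).const_sub _

lemma Q_tail (x : ℝ) : gaussianReal 0 1 (Set.Ioi x) = ENNReal.ofReal (Q x) := by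
  rw [← ENNReal.ofReal_toReal (measure_ne_top (gaussianReal 0 1) (Set.Ioi x))]
  congr 1
  rw [Q, stdNormCDF, ← Set.compl_Iic]
  exact probReal_compl_eq_one_sub measurableSet_Iic

lemma Q_le_one (x : ℝ) : Q x ≤ 1 := by
  rw [Q, stdNormCDF]
  linarith [ENNReal.toReal_nonneg (a := (gaussianReal 0 1) (Set.Iic x))]

lemma Q_lim : Tendsto Q atTop (nhds 0) := by
  have h := tendsto_cdf_atTop (gaussianReal 0 1)
  have e : Q = fun x => 1 - cdf (gaussianReal 0 1) x := by
    funext x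
    rw [cdf_eq_real]; rfl
  rw [e]
  simpa using h.const_sub 1

lemma pos_of {f f' : ℝ → ℝ} (hd : ∀ x, HasDerivAt f (f' x) x) (hn : ∀ x, f' x < 0)
    (hl : Tendsto f atTop (nhds 0)) (x : ℝ) : 0 < f x := by
  have ha : StrictAnti f := strictAnti_of_deriv_neg fun x => by rw [(hd x).deriv]; exact hn x
  have h1 : 0 ≤ f (x + 1) := ha.antitone.le_of_tendsto hl _
  have h2 : f (x + 1) < f x := ha (by linarith)
  linarith

lemma Q_pos (x : ℝ) : 0 < Q x :=
  pos_of hasDerivAt_Q (fun x => neg_neg_of_pos (ph_pos x)) Q_lim x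

lemma ph_lt (x : ℝ) : ph x < 2 * Real.exp (-x) := by
  rw [ph_eq]
  have h1 : (√(2 * π))⁻¹ < 1 := by
    apply inv_lt_one_of_one_lt₀
    rw [Real.lt_sqrt] <;> nlinarith [Real.pi_gt_three]
  have h2 : Real.exp (-x ^ 2 / 2) ≤ Real.exp (1 / 2) * Real.exp (-x) := by
    rw [← Real.exp_add]
    apply Real.exp_le_exp.2
    nlinarith [sq_nonneg (x - 1)]
  have h3 : Real.exp (1 / 2) < 2 := by
    have h : Real.exp (1 / 2) * Real.exp (1 / 2) = Real.exp 1 := by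
      rw [← Real.exp_add]; norm_num
    nlinarith [Real.exp_one_lt_d9, Real.exp_pos (1 / 2)]
  have h4 := Real.exp_pos (-x)
  have h5 := Real.exp_pos (-x ^ 2 / 2)
  nlinarith

lemma exp_neg_deriv (x : ℝ) : HasDerivAt (fun x : ℝ => Real.exp (-x)) (-Real.exp (-x)) x := by
  simpa using (hasDerivAt_neg x).exp

lemma Q_lt (x : ℝ) : Q x < 2 * Real.exp (-x) := by
  have h := pos_of (f := fun x => 2 * Real.exp (-x) - Q x)
    (fun x => ((exp_neg_deriv x).const_mul 2).sub (hasDerivAt_Q x))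
    (fun x => by linarith [ph_lt x])
    (by simpa using ((Real.tendsto_exp_neg_atTop_nhds_zero).const_mul 2).sub Q_lim) x
  linarith

lemma lim_of {g : ℝ → ℝ} (h0 : ∀ x, 0 < g x) (h1 : ∀ x, g x < 2 * Real.exp (-x)) (n : ℕ) :
    Tendsto (fun x => x ^ n * g x) atTop (nhds 0) := by
  have h := (Real.tendsto_pow_mul_exp_neg_atTop_nhds_zero n).const_mul 2
  rw [mul_zero] at h
  refine squeeze_zero' ?_ ?_ h
  · filter_upwards [eventually_ge_atTop 0] with x hx
    exact mul_nonneg (pow_nonneg hx n) (h0 x).le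
  · filter_upwards [eventually_ge_atTop 0] with x hx
    nlinarith [mul_le_mul_of_nonneg_left (h1 x).le (pow_nonneg hx n)]

lemma I_pos (x : ℝ) : 0 < ph x - x * Q x := by
  refine pos_of (f := fun x => ph x - x * Q x) (f' := fun x => -Q x) (fun x => ?_)
    (fun x => neg_neg_of_pos (Q_pos x)) ?_ x
  · have := (hasDerivAt_ph x).sub ((hasDerivAt_id x).mul (hasDerivAt_Q x))
    refine this.congr_deriv ?_
    simp only [id]
    ring
  · have h1 := lim_of ph_pos ph_lt 0
    have h2 := lim_of Q_pos Q_lt 1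
    simpa using h1.sub h2

lemma K_pos (x : ℝ) : 0 < (1 + x ^ 2) * Q x - x * ph x := by
  refine pos_of (f := fun x => (1 + x ^ 2) * Q x - x * ph x)
    (f' := fun x => -(2 * (ph x - x * Q x))) (fun x => ?_)
    (fun x => by linarith [I_pos x]) ?_ x
  · have := (((hasDerivAt_pow 2 x).const_add 1).mul (hasDerivAt_Q x)).sub
      ((hasDerivAt_id x).mul (hasDerivAt_ph x))
    refine this.congr_deriv ?_
    simp
    ring
  · have h1 := lim_of Q_pos Q_lt 0
    have h2 := lim_of Q_pos Q_lt 2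
    have h3 := lim_of ph_pos ph_lt 1
    have := (h1.add h2).sub h3
    simp only [add_zero, sub_zero] at this
    refine this.congr fun x => ?_
    ring

lemma G_pos (x : ℝ) : 0 < Q x ^ 2 + x * Q x * ph x - ph x ^ 2 := by
  refine pos_of (f := fun x => Q x ^ 2 + x * Q x * ph x - ph x ^ 2)
    (f' := fun x => -(ph x * ((1 + x ^ 2) * Q x - x * ph x))) (fun x => ?_)
    (fun x => neg_neg_of_pos (mul_pos (ph_pos x) (K_pos x))) ?_ x
  · have := (((hasDerivAt_Q x).pow 2).add
      (((hasDerivAt_id x).mul (hasDerivAt_Q x)).mul (hasDerivAt_ph x))).sub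
      ((hasDerivAt_ph x).pow 2)
    refine this.congr_deriv ?_
    simp
    ring
  · have h1 := lim_of Q_pos Q_lt 0
    have h2 := lim_of Q_pos Q_lt 1
    have h3 := lim_of ph_pos ph_lt 0
    have := ((h1.mul h1).add (h2.mul h3)).sub (h3.mul h3)
    simp only [mul_zero, add_zero, sub_zero] at this
    refine this.congr fun x => ?_
    ring

lemma r_lt (x a : ℝ) (ha : 0 < a) : ph (a + x) * Q x < ph x * Q (a + x) + a * Q x * Q (a + x) := by
  have h : StrictAnti (fun x => ph x / Q x - x) := by
    apply strictAnti_of_deriv_neg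
    intro x
    have hq := Q_pos x
    have := ((hasDerivAt_ph x).div (hasDerivAt_Q x) hq.ne').sub (hasDerivAt_id x)
    have e := this.deriv
    have e2 : deriv (fun x => ph x / Q x - x) x
      = (-x * ph x * Q x - ph x * -ph x) / Q x ^ 2 - 1 := e
    rw [e2, sub_neg, div_lt_one (by positivity)]
    linarith [G_pos x]
  have h2 := h (show x < a + x by linarith)
  simp only at h2
  have hq := Q_pos x
  have hq2 := Q_pos (a + x)
  have h3 : ph (a + x) / Q (a + x) < ph x / Q x + a := by linarith
  rw [div_add' _ _ _ hq.ne', div_lt_div_iff₀ hq2 hq] at h3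
  linarith

noncomputable def A (b z : ℝ) : ℝ := Real.exp (b ^ 2 / 2 - b * z) * Q (b - z)
noncomputable def B (a z : ℝ) : ℝ := Real.exp (a ^ 2 / 2 + a * z) * Q (a + z)

lemma A_pos (b z : ℝ) : 0 < A b z := mul_pos (Real.exp_pos _) (Q_pos _)
lemma B_pos (b z : ℝ) : 0 < B b z := mul_pos (Real.exp_pos _) (Q_pos _)

lemma A_ph (b z : ℝ) : Real.exp (b ^ 2 / 2 - b * z) * ph (b - z) = ph z := by
  have := ph_shift (-z) b
  rw [ph_neg] at this
  rw [← this]; ring_nf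

lemma hasDerivAt_A (b z : ℝ) : HasDerivAt (A b) (-b * A b z + ph z) z := by
  have h1 : HasDerivAt (fun z : ℝ => b ^ 2 / 2 - b * z) (-b) z := by
    simpa using ((hasDerivAt_id z).const_mul b).const_sub (b ^ 2 / 2)
  have h2 : HasDerivAt (fun z : ℝ => b - z) (-1) z := (hasDerivAt_id z).const_sub b
  have h3 := h1.exp.mul ((hasDerivAt_Q (b - z)).comp z h2)
  refine h3.congr_deriv ?_
  rw [← A_ph b z]
  simp [A]
  ring

lemma hasDerivAt_B (a z : ℝ) : HasDerivAt (B a) (a * B a z - ph z) z := by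
  have h1 : HasDerivAt (fun z : ℝ => a ^ 2 / 2 + a * z) a z := by
    simpa using ((hasDerivAt_id z).const_mul a).const_add (a ^ 2 / 2)
  have h2 : HasDerivAt (fun z : ℝ => a + z) 1 z := (hasDerivAt_id z).const_add a
  have h3 := h1.exp.mul ((hasDerivAt_Q (a + z)).comp z h2)
  refine h3.congr_deriv ?_
  rw [← ph_shift z a]
  simp [B]
  ring

lemma key (a b z : ℝ) (ha : 0 < a) (hb : 0 < b) :
    0 < (a + b) * (A b z * B a z) + Q z * (a * B a z - b * A b z) := by
  have hA := A_pos b z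
  have hB := B_pos a z
  have hQ := Q_pos z
  have hp := ph_pos z
  have h1 : b * A b z * Q z < ph z * (A b z + Q z) := by
    have i1 : 0 < A b z * (ph z - z * Q z) := mul_pos hA (I_pos z)
    have i2 : 0 < Real.exp (b ^ 2 / 2 - b * z) * (ph (b - z) - (b - z) * Q (b - z)) :=
      mul_pos (Real.exp_pos _) (I_pos _)
    have i3 : Real.exp (b ^ 2 / 2 - b * z) * (ph (b - z) - (b - z) * Q (b - z))
      = ph z - (b - z) * A b z := by
      rw [mul_sub, A_ph, A]; ring
    rw [i3] at i2
    nlinarith [mul_pos i2 hQ]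
  have h2 : ph z * (Q z - B a z) < a * B a z * Q z := by
    have i := mul_lt_mul_of_pos_left (r_lt z a ha) (Real.exp_pos (a ^ 2 / 2 + a * z))
    rw [← mul_assoc, ph_shift] at i
    have : Real.exp (a ^ 2 / 2 + a * z) * (ph z * Q (a + z) + a * Q z * Q (a + z))
      = ph z * B a z + a * Q z * B a z := by rw [B]; ring
    rw [this] at i
    linarith
  suffices h : b * A b z * (Q z - B a z) < a * B a z * (A b z + Q z) by linarith
  rcases le_or_gt (Q z - B a z) 0 with h | h
  · have : 0 < a * B a z * (A b z + Q z) := by positivity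
    have : b * A b z * (Q z - B a z) ≤ 0 := mul_nonpos_of_nonneg_of_nonpos (by positivity) h
    linarith
  · have h3 := mul_lt_mul h1 h2.le (mul_pos hp h) (by positivity)
    have hpq : 0 < ph z * Q z := by positivity
    refine lt_of_mul_lt_mul_left ?_ hpq.le
    linarith

/-- survival function in standardized variable -/
noncomputable def S (a b z : ℝ) : ℝ :=
  (a * A b z - b * B a z + (a + b) * Q z) / (a + b)

lemma hasDerivAt_S (a b z : ℝ) (ha : 0 < a) (hb : 0 < b) :
    HasDerivAt (S a b) (-(a * b / (a + b) * (A b z + B a z))) z := by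
  have h := (((((hasDerivAt_A b z).const_mul a).sub ((hasDerivAt_B a z).const_mul b))).add
    ((hasDerivAt_Q z).const_mul (a + b))).div_const (a + b)
  refine h.congr_deriv ?_
  field_simp
  ring

lemma lim_exp {c : ℝ} (hc : 0 < c) : Tendsto (fun x : ℝ => Real.exp (-(c * x))) atTop (nhds 0) :=
  Real.tendsto_exp_neg_atTop_nhds_zero.comp (tendsto_id.const_mul_atTop hc)

lemma lim_exp_mul {c : ℝ} (hc : 0 < c) {g : ℝ → ℝ} (h0 : ∀ x, 0 ≤ g x) (h1 : ∀ x, g x ≤ 1) :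
    Tendsto (fun x : ℝ => Real.exp (-(c * x)) * g x) atTop (nhds 0) := by
  refine squeeze_zero (fun x => mul_nonneg (Real.exp_pos _).le (h0 x)) (fun x => ?_) (lim_exp hc)
  exact mul_le_of_le_one_right (Real.exp_pos _).le (h1 x)

lemma lim_S (a b : ℝ) (ha : 0 < a) (hb : 0 < b) :
    Tendsto (fun z => Real.exp (-(a * z)) * S a b z) atTop (nhds 0) := by
  have h1 : Tendsto (fun z => Real.exp (-(a * z)) * Q z) atTop (nhds 0) :=
    lim_exp_mul ha (fun x => (Q_pos x).le) Q_le_one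
  have h2 : Tendsto (fun z => Real.exp (-(a * z)) * A b z) atTop (nhds 0) := by
    have h := (lim_exp_mul (c := a + b) (by positivity) (g := fun z => Q (b - z))
      (fun x => (Q_pos _).le) (fun x => Q_le_one _)).const_mul (Real.exp (b ^ 2 / 2))
    rw [mul_zero] at h
    refine h.congr fun z => ?_
    rw [A, ← mul_assoc, ← mul_assoc, ← Real.exp_add, ← Real.exp_add]
    ring_nf
  have h3 : Tendsto (fun z => Real.exp (-(a * z)) * B a z) atTop (nhds 0) := by
    have h := (Q_lim.comp (tendsto_atTop_add_const_left atTop a tendsto_id)).const_mul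
      (Real.exp (a ^ 2 / 2))
    rw [mul_zero] at h
    refine h.congr fun z => ?_
    rw [B, ← mul_assoc, ← Real.exp_add]
    simp
  have h := (((h2.const_mul a).sub (h3.const_mul b)).add (h1.const_mul (a + b))).div_const (a + b)
  simp only [mul_zero, sub_zero, add_zero, zero_div] at h
  refine h.congr fun z => ?_
  rw [S]; ring

lemma S_pos (a b z : ℝ) (ha : 0 < a) (hb : 0 < b) : 0 < S a b z := by
  have h := pos_of (f := fun z => Real.exp (-(a * z)) * S a b z)
    (f' := fun z => -(a * (Real.exp (-(a * z)) * (A b z + Q z)))) (fun z => ?_) (fun z => ?_)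
    (lim_S a b ha hb) z
  · exact (mul_pos_iff_of_pos_left (Real.exp_pos _)).1 h
  · have h1 : HasDerivAt (fun z : ℝ => -(a * z)) (-a) z := by
      simpa using (hasDerivAt_id z).const_mul (-a)
    refine (h1.exp.mul (hasDerivAt_S a b z ha hb)).congr_deriv ?_
    rw [S]
    field_simp
    ring
  · have := A_pos b z
    have := Q_pos z
    have : 0 < a * (Real.exp (-(a * z)) * (A b z + Q z)) := by positivity
    linarith

lemma haz_mono (a b : ℝ) (ha : 0 < a) (hb : 0 < b) :
    StrictMono (fun z => (A b z + B a z) / S a b z) := by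
  apply strictMono_of_deriv_pos
  intro z
  have hS := S_pos a b z ha hb
  have h := ((hasDerivAt_A b z).add (hasDerivAt_B a z)).div (hasDerivAt_S a b z ha hb) hS.ne'
  have e : deriv (fun z => (A b z + B a z) / S a b z) z = _ := h.deriv
  rw [e]
  apply div_pos _ (by positivity)
  have k := key a b z ha hb
  have : (-b * A b z + ph z + (a * B a z - ph z)) * S a b z -
      (A b + B a) z * -(a * b / (a + b) * (A b z + B a z))
      = (a + b) * (A b z * B a z) + Q z * (a * B a z - b * A b z) := by
    rw [S, Pi.add_apply]
    field_simp
    ring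
  rw [this]
  exact k

lemma conv_tail (m n : Measure ℝ) [SFinite n] (t : ℝ) :
    (m.conv n) (Set.Ioi t) = ∫⁻ x, n (Set.Ioi (t - x)) ∂m := by
  rw [← lintegral_indicator_one measurableSet_Ioi,
    Measure.lintegral_conv (measurable_one.indicator measurableSet_Ioi)]
  congr 1
  funext x
  rw [← lintegral_indicator_one measurableSet_Ioi]
  congr 1
  funext y
  simp only [Set.indicator, Set.mem_Ioi, sub_lt_iff_lt_add', Pi.one_apply]

lemma exp_lint {r : ℝ} (hr : 0 < r) {u U : ℝ → ℝ} (hu : ∀ x, 0 ≤ u x)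
    (hm : Measurable u)
    (hU : ∀ x, HasDerivAt U (r * (U x - u x)) x)
    (hl : Tendsto (fun x => Real.exp (-(r * x)) * U x) atTop (nhds 0)) :
    ∫⁻ x, ENNReal.ofReal (u x) ∂(expMeasure r) = ENNReal.ofReal (U 0) := by
  have hd : ∀ x ∈ Set.Ici (0 : ℝ), HasDerivAt (fun x => -(Real.exp (-(r * x)) * U x))
      (r * Real.exp (-(r * x)) * u x) x := by
    intro x _
    have h1 : HasDerivAt (fun z : ℝ => -(r * z)) (-r) x := by
      simpa using (hasDerivAt_id x).const_mul (-r)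
    refine (h1.exp.mul (hU x)).neg.congr_deriv ?_
    ring
  have hp : ∀ x ∈ Set.Ioi (0 : ℝ), 0 ≤ r * Real.exp (-(r * x)) * u x := fun x _ => by
    have := hu x
    positivity
  have hi := integral_Ioi_of_hasDerivAt_of_nonneg' hd hp (by simpa using hl.neg)
  have hI := integrableOn_Ioi_deriv_of_nonneg' hd hp (l := 0) (by simpa using hl.neg)
  have hpdf : Measurable (exponentialPDF r) := (measurable_exponentialPDFReal r).ennreal_ofReal
  have e : expMeasure r = volume.withDensity (exponentialPDF r) := rfl
  rw [e, lintegral_withDensity_eq_lintegral_mul _ hpdf hm.ennreal_ofReal]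
  have e2 : ∀ᵐ x ∂(volume : Measure ℝ),
      (exponentialPDF r * fun x => ENNReal.ofReal (u x)) x
      = (Set.Ioi (0:ℝ)).indicator (fun x => ENNReal.ofReal (r * Real.exp (-(r * x)) * u x)) x := by
    have : ∀ᵐ x ∂(volume : Measure ℝ), x ≠ 0 := by simp [ae_iff]
    filter_upwards [this] with x hx
    rw [Pi.mul_apply, exponentialPDF_eq]
    rcases lt_or_gt_of_ne hx with h | h
    · rw [Set.indicator_of_notMem (by simpa using h.le), if_neg (by linarith)]
      simp
    · rw [Set.indicator_of_mem (by simpa using h), if_pos h.le,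
        ENNReal.ofReal_mul (p := r * Real.exp (-(r * x))) (by positivity)]
  rw [lintegral_congr_ae e2, lintegral_indicator measurableSet_Ioi,
    ← ofReal_integral_eq_lintegral_ofReal hI
      ((ae_restrict_iff' measurableSet_Ioi).2 (ae_of_all _ hp)), hi]
  simp

lemma gauss_tail (μ σ t : ℝ) (hσ : 0 < σ) :
    gaussianReal μ (σ ^ 2).toNNReal (Set.Ioi t) = ENNReal.ofReal (Q ((t - μ) / σ)) := by
  have h : gaussianReal μ (σ ^ 2).toNNReal
      = ((gaussianReal 0 1).map (σ * ·)).map (· + μ) := by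
    rw [gaussianReal_map_const_mul, gaussianReal_map_add_const]
    congr 1
    · simp
    · ext
      simp [sq_nonneg]
  rw [h, Measure.map_map (by fun_prop) (by fun_prop), Measure.map_apply (by fun_prop)
    measurableSet_Ioi, ← Q_tail]
  congr 1
  ext x
  simp only [Set.mem_preimage, Function.comp, Set.mem_Ioi]
  rw [div_lt_iff₀ hσ]
  constructor <;> intro h <;> linarith

lemma cont_Q : Continuous Q :=
  continuous_iff_continuousAt.2 fun x => (hasDerivAt_Q x).continuousAt

lemma cont_A (b : ℝ) : Continuous (A b) :=
  continuous_iff_continuousAt.2 fun x => (hasDerivAt_A b x).continuousAt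

lemma step1 (α μ σ t : ℝ) (hα : 0 < α) (hσ : 0 < σ) :
    ((expMeasure α⁻¹).conv (gaussianReal μ (σ ^ 2).toNNReal)) (Set.Ioi t)
      = ENNReal.ofReal (A (σ / α) ((t - μ) / σ) + Q ((t - μ) / σ)) := by
  rw [conv_tail]
  simp_rw [gauss_tail _ _ _ hσ]
  rw [exp_lint (U := fun x => A (σ / α) ((t - x - μ) / σ) + Q ((t - x - μ) / σ))
    (inv_pos.2 hα) (fun x => (Q_pos _).le) (cont_Q.comp (by fun_prop)).measurable]
  · simp
  · intro x
    have hz : HasDerivAt (fun x => (t - x - μ) / σ) (-1 / σ) x :=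
      (((hasDerivAt_id x).const_sub t).sub_const μ).div_const σ
    refine (((hasDerivAt_A _ _).comp x hz).add ((hasDerivAt_Q _).comp x hz)).congr_deriv ?_
    field_simp
    ring
  · have h1 : Tendsto (fun x => Real.exp (-(α⁻¹ * x)) * Q ((t - x - μ) / σ)) atTop (nhds 0) :=
      lim_exp_mul (inv_pos.2 hα) (fun x => (Q_pos _).le) (fun _ => Q_le_one _)
    have hz : Tendsto (fun x => σ / α - (t - x - μ) / σ) atTop atTop := by
      have : Tendsto (fun x : ℝ => (σ / α - (t - μ) / σ) + σ⁻¹ * x) atTop atTop :=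
        tendsto_atTop_add_const_left _ _ (tendsto_id.const_mul_atTop (inv_pos.2 hσ))
      refine this.congr fun x => ?_
      field_simp
      ring
    have h2 := (Q_lim.comp hz).const_mul (Real.exp ((σ / α) ^ 2 / 2 - (t - μ) / α))
    have h := h2.add h1
    simp only [mul_zero, add_zero] at h
    refine h.congr fun x => ?_
    have e : (σ / α) ^ 2 / 2 - (t - μ) / α
        = -(α⁻¹ * x) + ((σ / α) ^ 2 / 2 - σ / α * ((t - x - μ) / σ)) := by
      field_simp
      ring
    rw [mul_add, A, ← mul_assoc, ← Real.exp_add, e]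
    rfl

lemma step2 (α₁ α₂ μ σ t : ℝ) (hα₁ : 0 < α₁) (hα₂ : 0 < α₂) (hσ : 0 < σ) :
    (ALG α₁ α₂ μ σ) (Set.Ioi t) = ENNReal.ofReal (S (σ / α₁) (σ / α₂) ((t - μ) / σ)) := by
  have := isProbabilityMeasure_expMeasure (inv_pos.2 hα₁)
  have := isProbabilityMeasure_expMeasure (inv_pos.2 hα₂)
  have : IsProbabilityMeasure ((expMeasure α₁⁻¹).map (fun x => -x)) :=
    Measure.isProbabilityMeasure_map (by fun_prop)
  have ha : 0 < σ / α₁ := by positivity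
  have hb : 0 < σ / α₂ := by positivity
  rw [ALG, AL, Measure.conv_comm (expMeasure α₂⁻¹), Measure.conv_assoc, conv_tail]
  simp_rw [step1 _ _ _ _ hα₂ hσ]
  rw [lintegral_map (by
      have := (cont_A (σ / α₂)).measurable
      have := cont_Q.measurable
      fun_prop) (by fun_prop)]
  rw [exp_lint (U := fun x => S (σ / α₁) (σ / α₂) ((t - -x - μ) / σ))
    (inv_pos.2 hα₁) (fun x => (add_pos (A_pos _ _) (Q_pos _)).le)]
  · simp
  · have := (cont_A (σ / α₂)).measurable
    have := cont_Q.measurable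
    fun_prop
  · intro x
    have hz : HasDerivAt (fun x => (t - -x - μ) / σ) (1 / σ) x := by
      simpa using (((hasDerivAt_id x).neg.const_sub t).sub_const μ).div_const σ
    refine ((hasDerivAt_S _ _ _ ha hb).comp x hz).congr_deriv ?_
    rw [S]
    field_simp
    ring
  · have hz : Tendsto (fun x => (t - -x - μ) / σ) atTop atTop := by
      have : Tendsto (fun x : ℝ => (t - μ) / σ + σ⁻¹ * x) atTop atTop :=
        tendsto_atTop_add_const_left _ _ (tendsto_id.const_mul_atTop (inv_pos.2 hσ))
      refine this.congr fun x => ?_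
      field_simp
      ring
    have h := ((lim_S _ _ ha hb).comp hz).const_mul (Real.exp ((t - μ) / α₁))
    rw [mul_zero] at h
    refine h.congr fun x => ?_
    simp only [Function.comp]
    rw [← mul_assoc, ← Real.exp_add]
    congr 2
    field_simp
    ring

end ALGaux

/-- Hazard Function's Behavior: for the density `f` and cumulative distribution
function `F` of `ALG(α₁, α₂, μ, σ)`, we have `F(t) < 1` for every `t`, and the hazard function
`h(t) = f(t)/(1 - F(t))` is strictly increasing on `ℝ`. -/
theorem ALG_hazard_strictMono (α₁ α₂ μ σ : ℝ)
    (hα₁ : 0 < α₁) (hα₂ : 0 < α₂) (hσ : 0 < σ)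
    (f F : ℝ → ℝ)
    (hf : f = fun t => (α₁ + α₂)⁻¹ *
      (Real.exp ((σ / (2 * α₂)) * (σ / α₂ - 2 * (t - μ) / σ)) *
          (1 - stdNormCDF (σ / α₂ - (t - μ) / σ)) +
       Real.exp ((σ / (2 * α₁)) * (σ / α₁ + 2 * (t - μ) / σ)) *
          (1 - stdNormCDF (σ / α₁ + (t - μ) / σ))))
    (hF : F = fun t => ((ALG α₁ α₂ μ σ) (Set.Iic t)).toReal) :
    (∀ t : ℝ, F t < 1) ∧ StrictMono (fun t => f t / (1 - F t)) := by
  have ha : 0 < σ / α₁ := by positivity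
  have hb : 0 < σ / α₂ := by positivity
  have := isProbabilityMeasure_expMeasure (inv_pos.2 hα₁)
  have := isProbabilityMeasure_expMeasure (inv_pos.2 hα₂)
  have : IsProbabilityMeasure ((expMeasure α₁⁻¹).map (fun x => -x)) :=
    Measure.isProbabilityMeasure_map (by fun_prop)
  have : IsProbabilityMeasure (ALG α₁ α₂ μ σ) := by
    unfold ALG AL
    infer_instance
  have hS : ∀ t, 1 - F t = ALGaux.S (σ / α₁) (σ / α₂) ((t - μ) / σ) := by
    intro t
    have h1 : (ALG α₁ α₂ μ σ).real (Set.Iic t)ᶜ = 1 - (ALG α₁ α₂ μ σ).real (Set.Iic t) :=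
      probReal_compl_eq_one_sub measurableSet_Iic
    rw [hF]
    refine h1.symm.trans ?_
    rw [Set.compl_Iic, measureReal_def, ALGaux.step2 _ _ _ _ _ hα₁ hα₂ hσ,
      ENNReal.toReal_ofReal (ALGaux.S_pos _ _ _ ha hb).le]
  constructor
  · intro t
    have := hS t
    have := ALGaux.S_pos _ _ ((t - μ) / σ) ha hb
    linarith
  · have hf2 : ∀ t, f t = (α₁ + α₂)⁻¹ * (ALGaux.A (σ / α₂) ((t - μ) / σ)
        + ALGaux.B (σ / α₁) ((t - μ) / σ)) := by
      intro t
      rw [hf]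
      simp only [ALGaux.A, ALGaux.B, ALGaux.Q]
      congr 4
      · field_simp
      · field_simp
    intro s t hst
    have h := ALGaux.haz_mono _ _ ha hb
      (show (s - μ) / σ < (t - μ) / σ from div_lt_div_of_pos_right (by linarith) hσ)
    simp only at h ⊢
    rw [hS, hS, hf2, hf2, mul_div_assoc, mul_div_assoc]
    exact mul_lt_mul_of_pos_left h (by positivity)
end

section
/- Let X be a real-valued random variable whose law has a continuous, strictly positive, differentiable density f with respect to Lebesgue measure and cumulative distribution function F, such that f(t) → 0 and F(t) → 1 as t → ∞. If the function t ↦ −log f(t) is convex on ℝ, then the hazard function h(t) = f(t)/(1 − F(t)) is monotonically increasing on ℝ; if t ↦ −log f(t) is concave on ℝ, then h is monotonically decreasing on ℝ. -/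
open MeasureTheory ProbabilityTheory Real Filter

/-- Four-point inequality for convex functions. -/
lemma four_point {g : ℝ → ℝ} (hg : ConvexOn ℝ Set.univ g) {a b u : ℝ} (hab : a ≤ b)
    (hu : 0 < u) : g (a + u) + g b ≤ g a + g (b + u) := by
  have hd : 0 < b - a + u := by linarith
  have hs : u / (b - a + u) + (b - a) / (b - a + u) = 1 := by field_simp; ring
  have hp : 0 ≤ u / (b - a + u) := by positivity
  have hq : 0 ≤ (b - a) / (b - a + u) := div_nonneg (by linarith) hd.le
  have h1 := hg.2 (Set.mem_univ a) (Set.mem_univ (b + u)) hp hq hs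
  have h2 := hg.2 (Set.mem_univ a) (Set.mem_univ (b + u)) hq hp (by rw [add_comm]; exact hs)
  simp only [smul_eq_mul] at h1 h2
  have e1 : u / (b - a + u) * a + (b - a) / (b - a + u) * (b + u) = b := by
    field_simp; ring
  have e2 : (b - a) / (b - a + u) * a + u / (b - a + u) * (b + u) = a + u := by
    field_simp; ring
  rw [e1] at h1
  rw [e2] at h2
  have e3 : (b - a) / (b - a + u) = 1 - u / (b - a + u) := by linarith
  rw [e3] at h1 h2
  nlinarith

lemma mul_le_of_log {a b c d : ℝ} (ha : 0 < a) (hb : 0 < b) (hc : 0 < c) (hd : 0 < d)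
    (h : Real.log a + Real.log b ≤ Real.log c + Real.log d) : a * b ≤ c * d := by
  rw [← Real.log_mul ha.ne' hb.ne', ← Real.log_mul hc.ne' hd.ne'] at h
  exact (Real.log_le_log_iff (mul_pos ha hb) (mul_pos hc hd)).1 h

/-- if the law of `X` has a continuous, strictly positive, differentiable density
`f` with CDF `F`, `f(t) → 0` and `F(t) → 1` as `t → ∞`, then convexity of `-log f` implies the
hazard function `h(t) = f(t)/(1 - F(t))` is monotonically increasing, and concavity of `-log f`
implies `h` is monotonically decreasing. -/
theorem hazard_monotone_of_logConcavity {Ω : Type*} [MeasurableSpace Ω]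
    (P : Measure Ω) [IsProbabilityMeasure P]
    (X : Ω → ℝ) (hX : Measurable X)
    (f : ℝ → ℝ) (hfc : Continuous f) (hfpos : ∀ t : ℝ, 0 < f t)
    (hfd : Differentiable ℝ f)
    (hlaw : P.map X = volume.withDensity (fun t => ENNReal.ofReal (f t)))
    (F : ℝ → ℝ) (hF : F = fun t => ((P.map X) (Set.Iic t)).toReal)
    (hftop : Tendsto f atTop (nhds 0)) (hFtop : Tendsto F atTop (nhds 1)) :
    (ConvexOn ℝ Set.univ (fun t => -Real.log (f t)) →
      Monotone (fun t => f t / (1 - F t))) ∧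
    (ConcaveOn ℝ Set.univ (fun t => -Real.log (f t)) →
      Antitone (fun t => f t / (1 - F t))) := by
  have hprob : IsProbabilityMeasure (P.map X) := Measure.isProbabilityMeasure_map hX.aemeasurable
  have hint : Integrable f := by
    refine ⟨hfc.aestronglyMeasurable, ?_⟩
    rw [hasFiniteIntegral_iff_ofReal (Eventually.of_forall fun t => (hfpos t).le)]
    have h1 : (P.map X) Set.univ = 1 := measure_univ
    rw [hlaw, withDensity_apply _ MeasurableSet.univ, Measure.restrict_univ] at h1
    rw [h1]
    exact ENNReal.one_lt_top
  have hS : ∀ t, 1 - F t = ∫ u in Set.Ioi (0:ℝ), f (t + u) := by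
    intro t
    have h1 : (P.map X).real (Set.Iic t)ᶜ = 1 - (P.map X).real (Set.Iic t) :=
      probReal_compl_eq_one_sub measurableSet_Iic
    have h2 : F t = (P.map X).real (Set.Iic t) := by rw [hF]; rfl
    rw [h2, ← h1, Set.compl_Iic, Measure.real, hlaw, withDensity_apply _ measurableSet_Ioi,
      ← integral_eq_lintegral_of_nonneg_ae (Eventually.of_forall fun t => (hfpos t).le)
        hfc.aestronglyMeasurable]
    rw [← (measurePreserving_add_left volume t).setIntegral_preimage_emb
      (measurableEmbedding_addLeft t) f (Set.Ioi t)]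
    simp
  have hintt : ∀ t, IntegrableOn (fun u => f (t + u)) (Set.Ioi 0) :=
    fun t => (hint.comp_add_left t).integrableOn
  have hSpos : ∀ t, 0 < 1 - F t := by
    intro t
    rw [hS t, setIntegral_pos_iff_support_of_nonneg_ae
      (Eventually.of_forall fun u => (hfpos _).le) (hintt t)]
    have : Function.support (fun u => f (t + u)) = Set.univ := by
      ext u; simp [(hfpos (t + u)).ne']
    rw [this]
    simp
  constructor
  · intro hg a b hab
    simp only
    rw [div_le_div_iff₀ (hSpos a) (hSpos b), hS, hS, ← integral_const_mul, ← integral_const_mul]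
    refine setIntegral_mono_on ((hintt b).const_mul _) ((hintt a).const_mul _)
      measurableSet_Ioi fun u hu => ?_
    have := four_point hg hab (Set.mem_Ioi.1 hu)
    exact mul_le_of_log (hfpos _) (hfpos _) (hfpos _) (hfpos _) (by linarith)
  · intro hg a b hab
    simp only
    rw [div_le_div_iff₀ (hSpos b) (hSpos a), hS, hS, ← integral_const_mul, ← integral_const_mul]
    refine setIntegral_mono_on ((hintt a).const_mul _) ((hintt b).const_mul _)
      measurableSet_Ioi fun u hu => ?_
    have := four_point hg.neg hab (Set.mem_Ioi.1 hu)
    simp only [Pi.neg_apply, neg_neg] at this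
    exact mul_le_of_log (hfpos _) (hfpos _) (hfpos _) (hfpos _) (by linarith)
end

section
/- Let X and Y be independent real-valued random variables whose laws are absolutely continuous with respect to Lebesgue measure with densities f_X and f_Y and cumulative distribution functions F_X and F_Y satisfying F_X(t) < 1 and F_Y(t) < 1 for all t ∈ ℝ. If the hazard functions h_X(t) = f_X(t)/(1 − F_X(t)) and h_Y(t) = f_Y(t)/(1 − F_Y(t)) are both (strictly) increasing on ℝ, then the law of X + Y has a density f_{X+Y} (the convolution of f_X and f_Y) with cumulative distribution function F_{X+Y} satisfying F_{X+Y}(t) < 1 for all t, and the hazard function h_{X+Y}(t) = f_{X+Y}(t)/(1 − F_{X+Y}(t)) is (strictly) increasing on ℝ. -/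
open MeasureTheory ProbabilityTheory Real Filter

structure IFR (f S : ℝ → ℝ) : Prop where
  nn : ∀ t, 0 ≤ f t
  meas : Measurable f
  int : Integrable f
  surv : ∀ t, S t = ∫ x in Set.Ioi t, f x
  pos : ∀ t, 0 < S t
  le_one : ∀ t, S t ≤ 1
  mono : Monotone (fun t => f t / S t)

namespace IFR
variable {f S : ℝ → ℝ}

lemma sub_eq (h : IFR f S) (x y : ℝ) : S x - S y = ∫ v in x..y, f v := by
  rw [h.surv, h.surv, ← intervalIntegral.integral_interval_add_Ioi (a := x) (b := y)
    h.int.integrableOn h.int.integrableOn]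
  ring

lemma cont (h : IFR f S) : Continuous S := by
  have : S = fun y => S 0 - ∫ v in (0:ℝ)..y, f v := by
    ext y; rw [← h.sub_eq]; ring
  rw [this]
  exact continuous_const.sub (intervalIntegral.continuous_primitive
    (fun a b => h.int.intervalIntegrable) 0)

lemma anti (h : IFR f S) : Antitone S := by
  intro x y hxy
  have := h.sub_eq x y
  have h2 := intervalIntegral.integral_nonneg hxy (fun u _ => h.nn u) (μ := volume)
  linarith

lemma ctble (h : IFR f S) : {x | ¬ ContinuousAt f x}.Countable := by
  refine h.mono.countable_not_continuousAt.mono ?_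
  intro x hx hc
  apply hx
  have : f = fun t => (f t / S t) * S t := by
    ext t; rw [div_mul_cancel₀ _ (h.pos t).ne']
  rw [this]
  exact hc.mul h.cont.continuousAt

lemma deriv_S (h : IFR f S) {x : ℝ} (hx : ContinuousAt f x) : HasDerivAt S (- f x) x := by
  have : S = fun y => S 0 - ∫ v in (0:ℝ)..y, f v := by
    ext y; rw [← h.sub_eq]; ring
  rw [this]
  exact (intervalIntegral.integral_hasDerivAt_right h.int.intervalIntegrable
    (h.meas.stronglyMeasurable.stronglyMeasurableAtFilter) hx).const_sub _

lemma log_eq (h : IFR f S) (x y : ℝ) :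
    ∫ v in x..y, (f v / S v) = log (S x) - log (S y) := by
  have := integral_eq_of_hasDerivAt_off_countable (fun t => - log (S t)) (fun v => f v / S v)
    (a := x) (b := y) h.ctble
    ((h.cont.log (fun t => (h.pos t).ne')).neg.continuousOn)
    (by
      intro t ht
      have hc : ContinuousAt f t := by
        by_contra hc; exact ht.2 hc
      have := ((h.deriv_S hc).log (h.pos t).ne').neg
      rw [neg_div, neg_neg] at this
      exact this)
    h.mono.intervalIntegrable
  rw [this]; ring

lemma logconc (h : IFR f S) (x : ℝ) {d e : ℝ} (hd : 0 ≤ d) (he : 0 ≤ e) :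
    S x * S (x + d + e) ≤ S (x + d) * S (x + e) := by
  have h1 := h.log_eq x (x + d)
  have h2 := h.log_eq (x + e) (x + d + e)
  have h3 : ∫ v in x..(x+d), (f v / S v) ≤ ∫ v in (x+e)..(x+d+e), (f v / S v) := by
    rw [← intervalIntegral.integral_comp_add_right (fun v => f v / S v) e]
    apply intervalIntegral.integral_mono_on (by linarith) h.mono.intervalIntegrable
    · refine Monotone.intervalIntegrable (u := fun v => f (v + e) / S (v + e)) ?_
      intro a b hab
      exact h.mono (by linarith : a + e ≤ b + e)
    · intro v _
      exact h.mono (by linarith : v ≤ v + e)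
  rw [h1, h2] at h3
  rw [← Real.log_le_log_iff (mul_pos (h.pos _) (h.pos _)) (mul_pos (h.pos _) (h.pos _)),
    Real.log_mul (h.pos _).ne' (h.pos _).ne', Real.log_mul (h.pos _).ne' (h.pos _).ne']
  linarith

lemma eq_mul (h : IFR f S) (x : ℝ) : f x = (f x / S x) * S x := by
  rw [div_mul_cancel₀ _ (h.pos x).ne']

lemma kernel (h : IFR f S) (x : ℝ) {d e : ℝ} (hd : 0 ≤ d) (he : 0 ≤ e) :
    f x * S (x + d + e) ≤ S (x + d) * f (x + e) := by
  have h1 := h.logconc x hd he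
  have h2 : f x / S x ≤ f (x + e) / S (x + e) := h.mono (by linarith)
  have h3 : 0 ≤ f x / S x := div_nonneg (h.nn _) (h.pos _).le
  rw [h.eq_mul x, h.eq_mul (x + e)]
  have := mul_pos (h.pos (x + d)) (h.pos (x+e))
  nlinarith [mul_le_mul h2 h1 (mul_pos (h.pos _) (h.pos _)).le (h3.trans h2)]

lemma kernel_strict (h : IFR f S) (hs : StrictMono (fun t => f t / S t))
    (x : ℝ) {d e : ℝ} (hd : 0 ≤ d) (he : 0 < e) :
    f x * S (x + d + e) < S (x + d) * f (x + e) := by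
  have h1 := h.logconc x hd he.le
  have h2 : f x / S x < f (x + e) / S (x + e) := hs (by linarith)
  have h3 : 0 ≤ f x / S x := div_nonneg (h.nn _) (h.pos _).le
  rw [h.eq_mul x, h.eq_mul (x + e)]
  have := mul_pos (h.pos (x + d)) (h.pos (x+e))
  nlinarith [mul_le_mul_of_nonneg_left h1 h3, mul_lt_mul_of_pos_right h2 this]

lemma bdd_left (h : IFR f S) (c : ℝ) : ∃ C, 0 ≤ C ∧ ∀ x ≤ c, f x ≤ C := by
  refine ⟨f c / S c, div_nonneg (h.nn _) (h.pos _).le, fun x hx => ?_⟩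
  rw [h.eq_mul x]
  have h2 : f x / S x ≤ f c / S c := h.mono hx
  have h3 : 0 ≤ f x / S x := div_nonneg (h.nn _) (h.pos _).le
  nlinarith [h.le_one x, h.pos x]

end IFR

lemma byparts {κ w : ℝ → ℝ} (hκ : Integrable κ) (hw : Integrable w) :
    ∫ r, (∫ v in Set.Iio r, κ v) * w r = ∫ v, κ v * (∫ r in Set.Ioi v, w r) := by
  have hm : MeasurableSet {p : ℝ × ℝ | p.2 < p.1} := measurableSet_lt measurable_snd measurable_fst
  have hi : Integrable ({p : ℝ × ℝ | p.2 < p.1}.indicator (fun p => κ p.2 * w p.1))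
      (volume.prod volume) := by
    refine Integrable.indicator ?_ hm
    simpa [mul_comm] using hw.mul_prod hκ
  have := integral_integral_swap (f := fun r v => {p : ℝ × ℝ | p.2 < p.1}.indicator
    (fun p => κ p.2 * w p.1) (r, v)) hi
  convert this using 1
  · congr 1; ext r
    rw [← integral_mul_const, ← integral_indicator measurableSet_Iio]
    congr 1
  · congr 1; ext v
    rw [← integral_const_mul, ← integral_indicator measurableSet_Ioi]
    congr 1

section core
variable {f S g T : ℝ → ℝ}

lemma prod_integrable (hf : IFR f S) (hg : IFR g T) (t : ℝ) :
    Integrable (fun s => f s * g (t - s)) := by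
  obtain ⟨C, hC0, hC⟩ := hf.bdd_left 0
  obtain ⟨C', hC0', hC'⟩ := hg.bdd_left t
  have hgi : Integrable (fun s => g (t - s)) := hg.int.comp_sub_left t
  refine Integrable.mono' ((hgi.const_mul C).add (hf.int.const_mul C')) ?_ ?_
  · exact (hf.meas.mul (hg.meas.comp (measurable_const.sub measurable_id))).aestronglyMeasurable
  · refine Eventually.of_forall fun s => ?_
    have h1 := hf.nn s
    have h2 := hg.nn (t - s)
    rw [Real.norm_of_nonneg (mul_nonneg h1 h2)]
    simp only [Pi.add_apply]
    rcases le_total s 0 with h | h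
    · nlinarith [hC s h, mul_nonneg hC0' h1, mul_le_mul_of_nonneg_right (hC s h) h2]
    · nlinarith [hC' (t - s) (by linarith), mul_nonneg hC0 h2,
        mul_le_mul_of_nonneg_left (hC' (t - s) (by linarith)) h1]

lemma ae_cont_comp {φ : ℝ → ℝ} (h : {x | ¬ ContinuousAt φ x}.Countable) (t : ℝ) :
    ∀ᵐ s : ℝ, ContinuousAt (fun t => φ (t - s)) t := by
  have h2 : ((fun s => t - s) ⁻¹' {x | ¬ ContinuousAt φ x}).Countable :=
    h.preimage (sub_right_injective)
  filter_upwards [h2.ae_notMem volume] with s hs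
  have : ContinuousAt φ (t - s) := by
    by_contra hc; exact hs hc
  exact ContinuousAt.comp (f := fun t => t - s) this (by fun_prop)

lemma conv_cont (hf : IFR f S) (hg : IFR g T) :
    Continuous (fun t => ∫ s, f s * g (t - s)) := by
  rw [continuous_iff_continuousAt]
  intro t₀
  -- split `f` at `0`
  let φ : ℝ → ℝ := (Set.Iic 0).indicator f
  let ψ : ℝ → ℝ := (Set.Ioi 0).indicator f
  have hφm : Measurable φ := hf.meas.indicator measurableSet_Iic
  have hψm : Measurable ψ := hf.meas.indicator measurableSet_Ioi
  have hφi : Integrable φ := hf.int.indicator measurableSet_Iic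
  have hψi : Integrable ψ := hf.int.indicator measurableSet_Ioi
  have hφle : ∀ s, φ s ≤ f s := fun s => Set.indicator_le_self' (fun _ _ => hf.nn _) s
  have hψle : ∀ s, ψ s ≤ f s := fun s => Set.indicator_le_self' (fun _ _ => hf.nn _) s
  have hφ0 : ∀ s, 0 ≤ φ s := fun s => Set.indicator_nonneg (fun _ _ => hf.nn _) s
  have hψ0 : ∀ s, 0 ≤ ψ s := fun s => Set.indicator_nonneg (fun _ _ => hf.nn _) s
  have hsum : ∀ s, f s = φ s + ψ s := by
    intro s
    simp only [φ, ψ, Set.indicator_apply, Set.mem_Iic, Set.mem_Ioi]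
    rcases le_or_gt s 0 with h | h
    · simp [h]
    · simp [h, not_le.2 h]
  have hmg : ∀ t, Measurable (fun s => g (t - s)) := fun t =>
    hg.meas.comp (measurable_const.sub measurable_id)
  have hint : ∀ t (u : ℝ → ℝ), Measurable u → (∀ s, 0 ≤ u s) → (∀ s, u s ≤ f s) →
      Integrable (fun s => u s * g (t - s)) := by
    intro t u hu hu0 hule
    refine (prod_integrable hf hg t).mono' (hu.mul (hmg t)).aestronglyMeasurable ?_
    refine Eventually.of_forall fun s => ?_
    rw [Real.norm_of_nonneg (mul_nonneg (hu0 s) (hg.nn _))]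
    exact mul_le_mul_of_nonneg_right (hule s) (hg.nn _)
  have heq : (fun t => ∫ s, f s * g (t - s)) =
      fun t => (∫ s, φ (t - s) * g s) + ∫ s, ψ s * g (t - s) := by
    ext t
    have h1 : ∫ s, φ (t - s) * g s = ∫ s, φ s * g (t - s) := by
      rw [← integral_sub_left_eq_self (fun s => φ s * g (t - s)) volume t]
      simp
    rw [h1, ← integral_add (hint t φ hφm hφ0 hφle) (hint t ψ hψm hψ0 hψle)]
    congr 1; ext s; rw [hsum s]; ring
  rw [heq]
  apply ContinuousAt.add
  · obtain ⟨C, hC0, hC⟩ := hf.bdd_left 0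
    have hφC : ∀ s, φ s ≤ C := by
      intro s
      simp only [φ, Set.indicator_apply, Set.mem_Iic]
      split_ifs with h
      · exact hC s h
      · exact hC0
    refine continuousAt_of_dominated (bound := fun s => C * g s) ?_ ?_ (hg.int.const_mul C) ?_
    · exact Eventually.of_forall fun t => ((hφm.comp
        (measurable_const.sub measurable_id)).mul hg.meas).aestronglyMeasurable
    · refine Eventually.of_forall fun t => Eventually.of_forall fun s => ?_
      rw [Real.norm_of_nonneg (mul_nonneg (hφ0 _) (hg.nn _))]
      exact mul_le_mul_of_nonneg_right (hφC _) (hg.nn _)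
    · have hct : {x | ¬ ContinuousAt φ x}.Countable := by
        refine (hf.ctble.union (Set.countable_singleton (0:ℝ))).mono ?_
        intro x hx
        by_contra hx'
        simp only [Set.mem_union, Set.mem_ofPred_eq, Set.mem_singleton_iff, not_or, not_not] at hx'
        apply hx
        rcases lt_or_gt_of_ne hx'.2 with h | h
        · refine hx'.1.congr ?_
          filter_upwards [Iio_mem_nhds h] with y hy
          simp [φ, Set.indicator_apply, le_of_lt (Set.mem_Iio.1 hy)]
        · refine (continuousAt_const (y := (0:ℝ))).congr ?_
          filter_upwards [Ioi_mem_nhds h] with y hy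
          simp [φ, Set.indicator_apply, Set.mem_Ioi.1 hy]
      filter_upwards [ae_cont_comp hct t₀] with s hs
      exact hs.mul continuousAt_const
  · obtain ⟨C, hC0, hC⟩ := hg.bdd_left (t₀ + 1)
    refine continuousAt_of_dominated (bound := fun s => C * ψ s) ?_ ?_ (hψi.const_mul C) ?_
    · exact Eventually.of_forall fun t => (hψm.mul (hmg t)).aestronglyMeasurable
    · filter_upwards [Iio_mem_nhds (by linarith : t₀ < t₀ + 1)] with t ht
      refine Eventually.of_forall fun s => ?_
      rw [Real.norm_of_nonneg (mul_nonneg (hψ0 _) (hg.nn _)), mul_comm C]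
      rcases le_or_gt s 0 with h | h
      · have : ψ s = 0 := by simp [ψ, Set.indicator_apply, h]
        simp [this]
      · exact mul_le_mul_of_nonneg_left (hC _ (by have := Set.mem_Iio.1 ht; linarith)) (hψ0 _)
    · filter_upwards [ae_cont_comp hg.ctble t₀] with s hs
      exact continuousAt_const.mul hs

/-- Kernel. -/
noncomputable def hzKer (f S : ℝ → ℝ) (a b s v : ℝ) : ℝ :=
  S (a - s) * f (b - v) - f (a - v) * S (b - s)

lemma hzKer_nonneg (hf : IFR f S) {a b s v : ℝ} (hab : a ≤ b) (hsv : s ≤ v) :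
    0 ≤ hzKer f S a b s v := by
  have := hf.kernel (a - v) (d := v - s) (e := b - a) (by linarith) (by linarith)
  rw [show a - v + (v - s) + (b - a) = b - s by ring, show a - v + (v - s) = a - s by ring,
    show a - v + (b - a) = b - v by ring] at this
  unfold hzKer; linarith

lemma hzKer_pos (hf : IFR f S) (hs : StrictMono (fun t => f t / S t)) {a b s v : ℝ} (hab : a < b)
    (hsv : s ≤ v) : 0 < hzKer f S a b s v := by
  have := hf.kernel_strict hs (a - v) (d := v - s) (e := b - a) (by linarith) (by linarith)
  rw [show a - v + (v - s) + (b - a) = b - s by ring, show a - v + (v - s) = a - s by ring,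
    show a - v + (b - a) = b - v by ring] at this
  unfold hzKer; linarith

lemma hzKer_integrable (hf : IFR f S) (a b s : ℝ) : Integrable (fun v => hzKer f S a b s v) :=
  ((hf.int.comp_sub_left b).const_mul _).sub ((hf.int.comp_sub_left a).mul_const _)

lemma hzKer_primitive (hf : IFR f S) (a b : ℝ) {s r : ℝ} (hsr : s ≤ r) :
    ∫ v in Set.Iio r, (Set.Ioi s).indicator (fun v => hzKer f S a b s v) v =
      S (a - s) * S (b - r) - S (a - r) * S (b - s) := by
  rw [setIntegral_indicator measurableSet_Ioi, Set.inter_comm, Set.Ioi_inter_Iio,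
    ← integral_Ioc_eq_integral_Ioo, ← intervalIntegral.integral_of_le hsr]
  unfold hzKer
  rw [intervalIntegral.integral_sub
    ((hf.int.comp_sub_left b).const_mul _).intervalIntegrable
    ((hf.int.comp_sub_left a).mul_const _).intervalIntegrable,
    intervalIntegral.integral_const_mul, intervalIntegral.integral_mul_const,
    intervalIntegral.integral_comp_sub_left, intervalIntegral.integral_comp_sub_left,
    ← hf.sub_eq, ← hf.sub_eq]
  ring

/-- inner integral after integration by parts -/
noncomputable def hzInner (f S g T : ℝ → ℝ) (a b δ s : ℝ) : ℝ :=
  ∫ v, (Set.Ioi s).indicator (fun v => hzKer f S a b s v) v *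
    (g (s + δ) * T v - g s * T (v + δ))

lemma T_shift (hg : IFR g T) (v δ : ℝ) : ∫ r in Set.Ioi v, g (r + δ) = T (v + δ) := by
  rw [hg.surv]
  have := integral_indicator (μ := volume) (f := g) (measurableSet_Ioi (a := v + δ))
  rw [← this, ← integral_add_right_eq_self (fun x => (Set.Ioi (v + δ)).indicator g x) δ,
    ← integral_indicator measurableSet_Ioi]
  congr 1; ext r; simp [Set.indicator_apply]

lemma hzInner_eq (hf : IFR f S) (hg : IFR g T) (a b δ s : ℝ) :
    hzInner f S g T a b δ s = ∫ r, (Set.Ioi s).indicator (fun r =>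
      (S (a - s) * S (b - r) - S (a - r) * S (b - s)) *
        (g (s + δ) * g r - g s * g (r + δ))) r := by
  have hgd : Integrable (fun r => g (r + δ)) := hg.int.comp_add_right δ
  have hw : Integrable (fun r => g (s + δ) * g r - g s * g (r + δ)) :=
    (hg.int.const_mul _).sub (hgd.const_mul _)
  have := byparts ((hzKer_integrable hf a b s).indicator (measurableSet_Ioi (a := s))) hw
  unfold hzInner
  refine Eq.trans ?_ (this.symm.trans ?_)
  rotate_left
  · congr 1; ext r
    by_cases h : s < r
    · rw [hzKer_primitive hf a b h.le, Set.indicator_of_mem (Set.mem_Ioi.2 h)]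
    · rw [Set.indicator_of_notMem (by simpa using h)]
      rw [setIntegral_indicator measurableSet_Ioi, Set.inter_comm, Set.Ioi_inter_Iio,
        Set.Ioo_eq_empty h]
      simp
  · congr 1; ext v
    rw [integral_sub (hg.int.const_mul _).integrableOn (hgd.const_mul _).integrableOn,
      integral_const_mul, integral_const_mul, T_shift hg, hg.surv v]

lemma hzInner_nonneg (hf : IFR f S) (hg : IFR g T) {a b δ : ℝ} (hab : a ≤ b) (hδ : 0 ≤ δ) (s : ℝ) :
    0 ≤ hzInner f S g T a b δ s := by
  refine integral_nonneg fun v => ?_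
  by_cases h : s < v
  · rw [Set.indicator_of_mem (Set.mem_Ioi.2 h)]
    refine mul_nonneg (hzKer_nonneg hf hab h.le) ?_
    have := hg.kernel s (d := v - s) (e := δ) (by linarith) hδ
    rw [show s + (v - s) = v by ring] at this
    linarith
  · simp [h]

lemma hzInner_pos (hf : IFR f S) (hg : IFR g T) (hfs : StrictMono (fun t => f t / S t))
    (hgs : StrictMono (fun t => g t / T t)) {a b δ : ℝ} (hab : a < b) (hδ : 0 < δ) (s : ℝ) :
    0 < hzInner f S g T a b δ s := by
  have hpos : ∀ v, s < v → 0 < hzKer f S a b s v * (g (s + δ) * T v - g s * T (v + δ)) := by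
    intro v h
    refine mul_pos (hzKer_pos hf hfs hab h.le) ?_
    have := hg.kernel_strict hgs s (d := v - s) (e := δ) (by linarith) hδ
    rw [show s + (v - s) = v by ring] at this
    linarith
  unfold hzInner
  rw [integral_pos_iff_support_of_nonneg]
  · have : Set.Ioi s ⊆ Function.support (fun v => (Set.Ioi s).indicator
        (fun v => hzKer f S a b s v) v * (g (s + δ) * T v - g s * T (v + δ))) := by
      intro v hv
      rw [Function.mem_support, Set.indicator_of_mem hv]
      exact (hpos v hv).ne'
    refine lt_of_lt_of_le ?_ (measure_mono this)
    simp
  · intro v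
    by_cases h : s < v
    · simp only [Set.indicator_of_mem (Set.mem_Ioi.2 h)]
      exact (hpos v h).le
    · simp [h]
  · refine Integrable.mul_bdd (c := |g (s + δ)| + |g s|)
      ((hzKer_integrable hf a b s).indicator measurableSet_Ioi) ?_ ?_
    · exact (((hg.cont.const_mul _).sub ((hg.cont.comp (continuous_add_const δ)).const_mul
        _))).aestronglyMeasurable
    · refine Eventually.of_forall fun v => ?_
      refine (norm_sub_le _ _).trans ?_
      rw [norm_mul, norm_mul, Real.norm_of_nonneg (hg.pos _).le, Real.norm_of_nonneg (hg.pos _).le]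
      have h1 := mul_le_mul_of_nonneg_left (hg.le_one v) (norm_nonneg (g (s + δ)))
      have h2 := mul_le_mul_of_nonneg_left (hg.le_one (v + δ)) (norm_nonneg (g s))
      simp only [Real.norm_eq_abs, mul_one] at *
      linarith

/-- The survival function of the sum. -/
noncomputable def SZ (S g : ℝ → ℝ) (t : ℝ) : ℝ := ∫ s, S (t - s) * g s

lemma main_identity (hf : IFR f S) (hg : IFR g T) (a b δ : ℝ) :
    Integrable (hzInner f S g T a b δ) ∧
    SZ S g (a + δ) * SZ S g b - SZ S g a * SZ S g (b + δ) = ∫ s, hzInner f S g T a b δ s := by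
  have hgd : Integrable (fun r => g (r + δ)) := hg.int.comp_add_right δ
  have hbd : ∀ (c : ℝ) (w : ℝ → ℝ), Integrable w → Integrable (fun s => S (c - s) * w s) := by
    intro c w hw
    refine hw.bdd_mul (c := 1) (hf.cont.comp (continuous_const.sub
      continuous_id)).aestronglyMeasurable (Eventually.of_forall fun v => ?_)
    rw [Real.norm_of_nonneg (hf.pos _).le]
    exact hf.le_one _
  have hshift : ∀ c, SZ S g (c + δ) = ∫ s, S (c - s) * g (s + δ) := by
    intro c
    unfold SZ
    rw [← integral_add_right_eq_self _ δ]
    congr 1; ext s; congr 2; ring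
  let G : ℝ × ℝ → ℝ := fun p => S (a - p.1) * S (b - p.2) *
    (g (p.1 + δ) * g p.2 - g p.1 * g (p.2 + δ))
  have hG1 : Integrable (fun p : ℝ × ℝ => (S (a - p.1) * g (p.1 + δ)) * (S (b - p.2) * g p.2))
    (volume.prod volume) := (hbd a _ hgd).mul_prod (hbd b _ hg.int)
  have hG2 : Integrable (fun p : ℝ × ℝ => (S (a - p.1) * g p.1) * (S (b - p.2) * g (p.2 + δ)))
    (volume.prod volume) := (hbd a _ hg.int).mul_prod (hbd b _ hgd)
  have hGe : G = fun p => (S (a - p.1) * g (p.1 + δ)) * (S (b - p.2) * g p.2) -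
      (S (a - p.1) * g p.1) * (S (b - p.2) * g (p.2 + δ)) := by
    ext p; simp only [G]; ring
  have hGi : Integrable G (volume.prod volume) := by rw [hGe]; exact hG1.sub hG2
  have hD : SZ S g (a + δ) * SZ S g b - SZ S g a * SZ S g (b + δ) =
      ∫ p, G p ∂(volume.prod volume) := by
    rw [hGe, integral_sub hG1 hG2, integral_prod_mul (fun s => S (a - s) * g (s + δ))
      (fun s => S (b - s) * g s), integral_prod_mul (fun s => S (a - s) * g s)
      (fun s => S (b - s) * g (s + δ)), hshift, hshift]
    rfl
  let A : Set (ℝ × ℝ) := {p | p.1 < p.2}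
  have hA : MeasurableSet A := measurableSet_lt measurable_fst measurable_snd
  let H : ℝ × ℝ → ℝ := fun p => A.indicator G p + A.indicator (fun p => G p.swap) p
  have hHi1 : Integrable (A.indicator G) (volume.prod volume) := hGi.indicator hA
  have hHi2 : Integrable (A.indicator (fun p => G p.swap)) (volume.prod volume) :=
    hGi.swap.indicator hA
  have hHi : Integrable H (volume.prod volume) := hHi1.add hHi2
  have hHG : ∫ p, H p ∂(volume.prod volume) = ∫ p, G p ∂(volume.prod volume) := by
    rw [integral_add hHi1 hHi2, ← integral_prod_swap (A.indicator (fun p => G p.swap)),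
      ← integral_add hHi1 (show Integrable (fun z : ℝ × ℝ => A.indicator (fun p => G p.swap) z.swap)
        (volume.prod volume) from hHi2.swap)]
    congr 1; ext ⟨s, r⟩
    simp only [A, Set.indicator_apply, Set.mem_ofPred_eq, Prod.swap_prod_mk]
    rcases lt_trichotomy s r with h | h | h
    · simp [h, h.le]
    · subst h; simp [G]; right; ring
    · simp [h, h.le]
  have hHin : ∀ s, ∫ r, H (s, r) = hzInner f S g T a b δ s := by
    intro s
    rw [hzInner_eq hf hg]
    congr 1; ext r
    simp only [H, A, G, Set.indicator_apply, Set.mem_ofPred_eq, Prod.swap_prod_mk, Set.mem_Ioi]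
    split_ifs
    · ring
    · simp
  have e : hzInner f S g T a b δ = fun s => ∫ r, H (s, r) := by
    ext s; rw [hHin]
  refine ⟨?_, ?_⟩
  · rw [e]; exact hHi.integral_prod_left
  · rw [hD, ← hHG, integral_prod _ hHi, e]

lemma SZ_nonneg (hf : IFR f S) (hg : IFR g T) {a b δ : ℝ} (hab : a ≤ b) (hδ : 0 ≤ δ) :
    SZ S g a * SZ S g (b + δ) ≤ SZ S g (a + δ) * SZ S g b := by
  have h := (main_identity hf hg a b δ).2
  have : 0 ≤ ∫ s, hzInner f S g T a b δ s := integral_nonneg fun s => hzInner_nonneg hf hg hab hδ s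
  linarith

lemma SZ_strict (hf : IFR f S) (hg : IFR g T) (hfs : StrictMono (fun t => f t / S t))
    (hgs : StrictMono (fun t => g t / T t)) {a b δ : ℝ} (hab : a < b) (hδ : 0 < δ) :
    SZ S g a * SZ S g (b + δ) < SZ S g (a + δ) * SZ S g b := by
  obtain ⟨hi, h⟩ := main_identity hf hg a b δ
  have : 0 < ∫ s, hzInner f S g T a b δ s := by
    rw [integral_pos_iff_support_of_nonneg (hzInner_nonneg hf hg hab.le hδ.le) hi]
    have : Function.support (hzInner f S g T a b δ) = Set.univ := by
      ext s; simp [(hzInner_pos hf hg hfs hgs hab hδ s).ne']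
    rw [this]; simp
  linarith

lemma SZ_pos (hf : IFR f S) (hg : IFR g T) (t : ℝ) : 0 < SZ S g t := by
  have hi : Integrable (fun s => S (t - s) * g s) := by
    refine hg.int.bdd_mul (c := 1) (hf.cont.comp (continuous_const.sub
      continuous_id)).aestronglyMeasurable (Eventually.of_forall fun v => ?_)
    rw [Real.norm_of_nonneg (hf.pos _).le]
    exact hf.le_one _
  unfold SZ
  rw [integral_pos_iff_support_of_nonneg (fun s => mul_nonneg (hf.pos _).le (hg.nn _)) hi]
  have h1 : Function.support (fun s => S (t - s) * g s) = Function.support g := by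
    ext s; simp [(hf.pos (t - s)).ne']
  rw [h1]
  have h2 : 0 < ∫ x in Set.Ioi 0, g x := by rw [← hg.surv]; exact hg.pos 0
  have h3 : 0 < ∫ x, g x := h2.trans_le (setIntegral_le_integral hg.int
    (Eventually.of_forall hg.nn))
  rwa [integral_pos_iff_support_of_nonneg hg.nn hg.int] at h3

/-- From multiplicative concavity of a survival function to monotone hazard. -/
lemma hazard_mono {Z z : ℝ → ℝ} (hpos : ∀ t, 0 < Z t) (hd : ∀ t, HasDerivAt Z (- z t) t)
    (hc : ∀ a b δ : ℝ, a ≤ b → 0 ≤ δ → Z a * Z (b + δ) ≤ Z (a + δ) * Z b) :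
    Monotone (fun t => z t / Z t) := by
  intro a b hab
  have ha := (hd a).tendsto_slope_zero_right
  have hb := (hd b).tendsto_slope_zero_right
  have h1 := ha.mul_const (Z b)
  have h2 := hb.const_mul (Z a)
  have h3 : Z a * (- z b) ≤ - z a * Z b := by
    refine le_of_tendsto_of_tendsto h2 h1 ?_
    filter_upwards [self_mem_nhdsWithin] with δ hδ
    have hδ' : (0:ℝ) < δ := hδ
    have := hc a b δ hab hδ'.le
    simp only [smul_eq_mul]
    have h4 : 0 < δ⁻¹ := inv_pos.2 hδ'
    nlinarith [mul_le_mul_of_nonneg_left this h4.le]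
  show z a / Z a ≤ z b / Z b
  rw [div_le_div_iff₀ (hpos a) (hpos b)]
  linarith

lemma hazard_strict {Z z : ℝ → ℝ} (hpos : ∀ t, 0 < Z t) (hd : ∀ t, HasDerivAt Z (- z t) t)
    (hm : Monotone (fun t => z t / Z t))
    (hc : ∀ a b δ : ℝ, a < b → 0 < δ → Z a * Z (b + δ) < Z (a + δ) * Z b) :
    StrictMono (fun t => z t / Z t) := by
  intro a b hab
  have hL : ∀ t, HasDerivAt (fun t => log (Z t)) (- z t / Z t) t := fun t =>
    (hd t).log (hpos t).ne'
  obtain ⟨m, hm'⟩ : ∃ m, m = (a + b) / 2 := ⟨_, rfl⟩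
  have ham : a < m := by linarith
  have hmb : m < b := by linarith
  have hcont : Continuous (fun t => log (Z t)) :=
    continuous_iff_continuousAt.2 fun t => (hL t).continuousAt
  obtain ⟨x, hx, hxe⟩ := exists_hasDerivAt_eq_slope (fun t => log (Z t)) (fun t => - z t / Z t)
    ham hcont.continuousOn (fun t _ => hL t)
  obtain ⟨y, hy, hye⟩ := exists_hasDerivAt_eq_slope (fun t => log (Z t)) (fun t => - z t / Z t)
    hmb hcont.continuousOn (fun t _ => hL t)
  have h1 := hc a m (m - a) ham (by linarith)
  rw [show m + (m - a) = b by rw [hm']; ring, show a + (m - a) = m by ring,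
    ← Real.log_lt_log_iff (mul_pos (hpos _) (hpos _)) (mul_pos (hpos _) (hpos _)),
    Real.log_mul (hpos _).ne' (hpos _).ne', Real.log_mul (hpos _).ne' (hpos _).ne'] at h1
  have h2 : - z y / Z y < - z x / Z x := by
    rw [hxe, hye, show b - m = m - a by rw [hm']; ring]
    exact div_lt_div_of_pos_right (by linarith) (by linarith)
  rw [neg_div, neg_div] at h2
  have h3 : z a / Z a ≤ z x / Z x := hm hx.1.le
  have h4 : z y / Z y ≤ z b / Z b := hm hy.2.le
  show z a / Z a < z b / Z b
  linarith

end core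

lemma IFR.of_law (μ : Measure ℝ) [IsProbabilityMeasure μ] (f F : ℝ → ℝ) (h0 : ∀ t, 0 ≤ f t)
    (hlaw : μ = volume.withDensity (fun t => ENNReal.ofReal (f t)))
    (hF : F = fun t => (μ (Set.Iic t)).toReal) (hlt : ∀ t, F t < 1)
    (hm : Monotone (fun t => f t / (1 - F t))) : IFR f (fun t => 1 - F t) := by
  have hpos : ∀ t, 0 < 1 - F t := fun t => by linarith [hlt t]
  have hFm : Monotone F := by
    intro a b hab
    rw [hF]
    exact ENNReal.toReal_mono (measure_ne_top _ _) (measure_mono (Set.Iic_subset_Iic.2 hab))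
  have hfm : Measurable f := by
    have : f = fun t => (f t / (1 - F t)) * (1 - F t) := by
      ext t; rw [div_mul_cancel₀ _ (hpos t).ne']
    rw [this]
    exact hm.measurable.mul (measurable_const.sub hFm.measurable)
  have hone : ∫⁻ t, ENNReal.ofReal (f t) = 1 := by
    have := measure_univ (μ := μ)
    rwa [hlaw, withDensity_apply _ MeasurableSet.univ, setLIntegral_univ] at this
  have hint : Integrable f := by
    refine ⟨hfm.aestronglyMeasurable, ?_⟩
    rw [hasFiniteIntegral_iff_ofReal (Eventually.of_forall h0), hone]
    exact ENNReal.one_lt_top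
  refine ⟨h0, hfm, hint, fun t => ?_, hpos, fun t => ?_, hm⟩
  · have h1 : 1 - F t = μ.real (Set.Ioi t) := by
      rw [← Set.compl_Iic, probReal_compl_eq_one_sub measurableSet_Iic, hF]; rfl
    rw [h1, measureReal_def, hlaw, withDensity_apply _ measurableSet_Ioi,
      integral_eq_lintegral_of_nonneg_ae (Eventually.of_forall h0) hfm.aestronglyMeasurable]
  · have : 0 ≤ F t := by rw [hF]; exact ENNReal.toReal_nonneg
    linarith

theorem hazard_sum_monotone {Ω : Type*} [MeasurableSpace Ω]
    (P : Measure Ω) [IsProbabilityMeasure P]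
    (X Y : Ω → ℝ) (hX : Measurable X) (hY : Measurable Y) (hXY : IndepFun X Y P)
    (fX fY : ℝ → ℝ) (hfX0 : ∀ t : ℝ, 0 ≤ fX t) (hfY0 : ∀ t : ℝ, 0 ≤ fY t)
    (hlawX : P.map X = volume.withDensity (fun t => ENNReal.ofReal (fX t)))
    (hlawY : P.map Y = volume.withDensity (fun t => ENNReal.ofReal (fY t)))
    (FX FY : ℝ → ℝ)
    (hFX : FX = fun t => ((P.map X) (Set.Iic t)).toReal)
    (hFY : FY = fun t => ((P.map Y) (Set.Iic t)).toReal)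
    (hFXlt : ∀ t : ℝ, FX t < 1) (hFYlt : ∀ t : ℝ, FY t < 1)
    (hhX : Monotone (fun t => fX t / (1 - FX t)))
    (hhY : Monotone (fun t => fY t / (1 - FY t)))
    (fSum FSum : ℝ → ℝ)
    (hfSum : fSum = fun t => ∫ s : ℝ, fX s * fY (t - s))
    (hFSum : FSum = fun t => ((P.map (fun ω => X ω + Y ω)) (Set.Iic t)).toReal) :
    P.map (fun ω => X ω + Y ω)
        = volume.withDensity (fun t => ENNReal.ofReal (fSum t)) ∧
    (∀ t : ℝ, FSum t < 1) ∧
    Monotone (fun t => fSum t / (1 - FSum t)) ∧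
    (StrictMono (fun t => fX t / (1 - FX t)) →
      StrictMono (fun t => fY t / (1 - FY t)) →
      StrictMono (fun t => fSum t / (1 - FSum t))) := by
  haveI : IsProbabilityMeasure (P.map X) := Measure.isProbabilityMeasure_map hX.aemeasurable
  haveI : IsProbabilityMeasure (P.map Y) := Measure.isProbabilityMeasure_map hY.aemeasurable
  haveI hPZ : IsProbabilityMeasure (P.map (fun ω => X ω + Y ω)) :=
    Measure.isProbabilityMeasure_map (hX.add hY).aemeasurable
  have iX := IFR.of_law (P.map X) fX FX hfX0 hlawX hFX hFXlt hhX
  have iY := IFR.of_law (P.map Y) fY FY hfY0 hlawY hFY hFYlt hhY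
  have hconv : P.map (fun ω => X ω + Y ω) = (P.map X).conv (P.map Y) :=
    hXY.map_add_eq_map_conv_map hX hY
  have hfS0 : ∀ t, 0 ≤ fSum t := by
    intro t; rw [hfSum]; exact integral_nonneg fun s => mul_nonneg (hfX0 _) (hfY0 _)
  have hlaw : P.map (fun ω => X ω + Y ω)
        = volume.withDensity (fun t => ENNReal.ofReal (fSum t)) := by
    rw [hconv, hlawX, hlawY, conv_withDensity_eq_lconvolution iX.meas.ennreal_ofReal
      iY.meas.ennreal_ofReal]
    congr 1
    ext t
    rw [lconvolution_def, hfSum]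
    simp only
    rw [ofReal_integral_eq_lintegral_ofReal (prod_integrable iX iY t)
      (Eventually.of_forall fun s => mul_nonneg (hfX0 _) (hfY0 _))]
    congr 1; ext s
    rw [ENNReal.ofReal_mul (hfX0 s), neg_add_eq_sub]
  have hcont : Continuous fSum := by rw [hfSum]; exact conv_cont iX iY
  have hSreal : ∀ t, 1 - FSum t = (P.map (fun ω => X ω + Y ω)).real (Set.Ioi t) := by
    intro t
    rw [← Set.compl_Iic, probReal_compl_eq_one_sub measurableSet_Iic, hFSum]; rfl
  have hSZ : ∀ t, 1 - FSum t = SZ (fun t => 1 - FX t) fY t := by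
    intro t
    rw [hSreal, measureReal_def, hconv, Measure.conv_comm,
      ← lintegral_indicator_one measurableSet_Ioi,
      Measure.lintegral_conv (measurable_one.indicator measurableSet_Ioi)]
    have h1 : ∀ y, ∫⁻ x, (Set.Ioi t).indicator 1 (y + x) ∂(P.map X)
        = ENNReal.ofReal (1 - FX (t - y)) := by
      intro y
      have : ∀ x, (Set.Ioi t).indicator (1 : ℝ → ENNReal) (y + x)
          = (Set.Ioi (t - y)).indicator 1 x := by
        intro x
        simp [Set.indicator_apply, sub_lt_iff_lt_add']
      simp only [this]
      rw [lintegral_indicator_one measurableSet_Ioi, ← Set.compl_Iic]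
      have h2 : 1 - FX (t - y) = (P.map X).real (Set.Iic (t - y))ᶜ := by
        rw [probReal_compl_eq_one_sub measurableSet_Iic, hFX]; rfl
      rw [h2, ofReal_measureReal]
    simp only [h1]
    have hm : Measurable (fun y => 1 - FX (t - y)) :=
      iX.cont.measurable.comp (measurable_const.sub measurable_id)
    rw [hlawY, lintegral_withDensity_eq_lintegral_mul _ iY.meas.ennreal_ofReal
      hm.ennreal_ofReal]
    unfold SZ
    rw [integral_eq_lintegral_of_nonneg_ae
      (Eventually.of_forall fun s => mul_nonneg (iX.pos _).le (hfY0 _))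
      (hm.mul iY.meas).aestronglyMeasurable]
    congr 2; ext s
    rw [ENNReal.ofReal_mul (iX.pos _).le, mul_comm]
    rfl
  have hpos : ∀ t, 0 < 1 - FSum t := fun t => by rw [hSZ]; exact SZ_pos iX iY t
  have hint : Integrable fSum := by
    refine ⟨hcont.aestronglyMeasurable, ?_⟩
    rw [hasFiniteIntegral_iff_ofReal (Eventually.of_forall hfS0)]
    have := measure_univ (μ := P.map (fun ω => X ω + Y ω))
    rw [hlaw, withDensity_apply _ MeasurableSet.univ, setLIntegral_univ] at this
    rw [this]
    exact ENNReal.one_lt_top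
  have hder : ∀ t, HasDerivAt (fun t => 1 - FSum t) (- fSum t) t := by
    intro t
    have hs : ∀ t, 1 - FSum t = ∫ x in Set.Ioi t, fSum x := by
      intro t
      rw [hSreal, measureReal_def, hlaw, withDensity_apply _ measurableSet_Ioi,
        integral_eq_lintegral_of_nonneg_ae (Eventually.of_forall hfS0)
          hcont.aestronglyMeasurable]
    have : (fun t => 1 - FSum t) = fun y => (1 - FSum 0) - ∫ v in (0:ℝ)..y, fSum v := by
      ext y
      rw [hs, hs, ← intervalIntegral.integral_interval_add_Ioi (a := 0) (b := y)
        hint.integrableOn hint.integrableOn]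
      ring
    rw [this]
    exact (hcont.integral_hasStrictDerivAt 0 t).hasDerivAt.const_sub _
  have hmono : Monotone (fun t => fSum t / (1 - FSum t)) := by
    refine hazard_mono hpos hder ?_
    intro a b δ hab hδ
    simp only [hSZ]
    exact SZ_nonneg iX iY hab hδ
  refine ⟨hlaw, fun t => by linarith [hpos t], hmono, fun hsX hsY => ?_⟩
  refine hazard_strict hpos hder hmono ?_
  intro a b δ hab hδ
  simp only [hSZ]
  exact SZ_strict iX iY hsX hsY hab hδ
end
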